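/- arXiv:1512.07177 — 2 statements merged into one kernel-verified Lean document; each statement's English description precedes it below -/
import Mathlib

section
/- Fix integers k ≥ 3 and 1 ≤ d < k/2, and let g(k,d) := 1 − (1 − (k−d)(k−2d−1)/(k−1)²)·(1 − 1/k)^{k−d}. Then for every ε > 0 there exists n₀ such that for all n ≥ n₀, every k-uniform hypergraph H on n vertices with δ_d(H) ≥ (g(k,d) + ε)·C(n−d, k−d) contains a fractional matching of size n/k (a perfect fractional matching). -/
/-- A fractional matching of a `k`-graph `H` on `Fin n`: weights in `[0,1]`, supported on the
edges, with total weight at each vertex at most `1`. -/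
def IsFracMatching {n : ℕ} (H : Finset (Finset (Fin n))) (w : Finset (Fin n) → ℝ) : Prop :=
  (∀ e, 0 ≤ w e ∧ w e ≤ 1) ∧ (∀ e ∉ H, w e = 0) ∧
    ∀ v : Fin n, ∑ e ∈ H.filter (fun e => v ∈ e), w e ≤ 1

/-- The `s` largest elements with respect to `u`. -/
lemma exists_top {Ω : Type*} [Fintype Ω] [DecidableEq Ω] (u : Ω → ℝ) (s : ℕ)
    (hs : s ≤ Fintype.card Ω) :
    ∃ T : Finset Ω, T.card = s ∧ ∀ x ∈ T, ∀ y ∉ T, u y ≤ u x := by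
  induction s with
  | zero => exact ⟨∅, by simp, by simp⟩
  | succ s ih =>
    obtain ⟨T, hT, hTu⟩ := ih (by omega)
    have hne : (Tᶜ).Nonempty := by
      rw [← Finset.card_pos, Finset.card_compl]; omega
    obtain ⟨z, hz, hzm⟩ := Finset.exists_max_image Tᶜ u hne
    have hz' : z ∉ T := by simpa using hz
    refine ⟨insert z T, by rw [Finset.card_insert_of_notMem hz', hT], ?_⟩
    intro x hx y hy
    simp only [Finset.mem_insert, not_or] at hx hy
    rcases hx with rfl | hx
    · exact hzm y (by simpa using hy.2)
    · exact hTu x hx y hy.2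

lemma sum_removeNth {Ω : Type*} [Fintype Ω] {r : ℕ} (Q : Ω → (Fin r → Ω) → ℝ)
    (j : Fin (r + 1)) :
    ∑ f : Fin (r + 1) → Ω, Q (f j) (j.removeNth f) = ∑ f' : Fin r → Ω, ∑ x, Q x f' := by
  rw [← (Fin.insertNthEquiv (fun _ => Ω) j).sum_comp, Fintype.sum_prod_type, Finset.sum_comm]
  simp [Fin.insertNthEquiv]

lemma pointwise (a z c ρ : ℝ) (ha : 0 < a) (hz : 0 ≤ z) (hc : c ≤ a) (h1 : 1 ≤ 2 * ρ)
    (h2 : ρ ≤ 1) :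
    (if a ≤ z then (1:ℝ) else 0) + (if c ≤ z then 1 else 0) ≤ 2 * ρ + 2 * (z - ρ * c) / a := by
  have key : ∀ x : ℝ, (x - 2 * ρ) * a ≤ 2 * (z - ρ * c) → x ≤ 2 * ρ + 2 * (z - ρ * c) / a := by
    intro x hx
    have := (le_div_iff₀ ha).2 hx
    linarith
  apply key
  split_ifs with h3 h4 h4
  · nlinarith
  · linarith
  · rcases le_total 0 c with h | h <;> nlinarith
  · nlinarith

lemma pw2 {Ω : Type*} [Fintype Ω] [DecidableEq Ω] {r : ℕ} (u : Ω → ℝ) (hu : ∀ x, 0 ≤ u x)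
    (T : Finset Ω) (τ : ℝ) (hT2 : ∀ y ∉ T, u y ≤ τ) (Q : Ω → (Fin r → Ω) → ℝ)
    (hQ : Q = fun x f' => if ∀ i, f' i ∉ T then
      (if x ∉ T then (if 1 - τ ≤ ∑ i, u (f' i) then u x else 0) else
        (if 1 ≤ u x + ∑ i, u (f' i) then 1 else 0) - 1) else 0)
    (f : Fin (r + 1) → Ω) :
    (if 1 ≤ ∑ i, u (f i) then (1:ℝ) else 0) ≤
      1 - (if ∀ i, f i ∉ T then 1 else 0) + ∑ j, Q (f j) (j.removeNth f) := by
  have hsum : ∀ j : Fin (r+1), ∑ i, u (f i) = u (f j) + ∑ i, u (j.removeNth f i) := by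
    intro j
    rw [Fin.sum_univ_succAbove _ j]; rfl
  by_cases h0 : ∀ i, f i ∉ T
  · have hQj : ∀ j : Fin (r+1), Q (f j) (j.removeNth f) =
        if 1 - τ ≤ ∑ i, u (j.removeNth f i) then u (f j) else 0 := by
      intro j
      have : ∀ i, j.removeNth f i ∉ T := fun i => h0 _
      simp only [hQ]
      rw [if_pos this, if_pos (h0 j)]
    simp only [hQj]
    rw [if_pos h0]
    split_ifs with h1
    · have : ∀ j : Fin (r+1), 1 - τ ≤ ∑ i, u (j.removeNth f i) := by
        intro j
        have := hsum j
        have := hT2 _ (h0 j)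
        linarith
      simp only [this, if_true]
      linarith
    · have : 0 ≤ ∑ j : Fin (r+1), if 1 - τ ≤ ∑ i, u (j.removeNth f i) then u (f j) else 0 := by
        apply Finset.sum_nonneg
        intro j _
        split_ifs
        · exact hu _
        · exact le_rfl
      linarith
  · rw [if_neg h0]
    push Not at h0
    obtain ⟨j, hj⟩ := h0
    have hz : ∀ j' ≠ j, Q (f j') (j'.removeNth f) = 0 := by
      intro j' hj'
      simp only [hQ]
      rw [if_neg]
      push Not
      obtain ⟨i, hi⟩ := Fin.exists_succAbove_eq hj'.symm
      exact ⟨i, by simpa [Fin.removeNth, hi] using hj⟩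
    rw [Finset.sum_eq_single j (fun b _ hb => hz b hb) (by simp), hsum j]
    simp only [hQ]
    rw [if_neg (not_not.2 hj)]
    split_ifs <;> norm_num

lemma key {Ω : Type*} [Fintype Ω] [DecidableEq Ω] (k r s : ℕ) (hk : 2 ≤ k) (h1 : k ≤ 2 * r + 1)
    (h2 : r + 1 ≤ k) (hcard : Fintype.card Ω = k * s) (u : Ω → ℝ) (hu : ∀ x, 0 ≤ u x)
    (hsum : ∑ x, u x < s) :
    ∑ f : Fin (r + 1) → Ω, (if 1 ≤ ∑ i, u (f i) then (1:ℝ) else 0) ≤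
      ((k:ℝ) * s) ^ (r + 1) - (((k:ℝ) - 1) * s) ^ (r + 1) *
        (1 - ((r:ℝ) + 1) * (2 * r + 1 - k) / ((k:ℝ) - 1) ^ 2) := by
  have hs : 0 < (s:ℝ) := lt_of_le_of_lt (Finset.sum_nonneg fun x _ => hu x) hsum
  have hs' : 0 < s := by exact_mod_cast hs
  obtain ⟨T, hTc, hT⟩ := exists_top u s (by rw [hcard]; nlinarith)
  have hTne : T.Nonempty := by rw [← Finset.card_pos]; omega
  obtain ⟨x0, hx0, hmin⟩ := Finset.exists_min_image T u hTne
  set τ := u x0 with hτ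
  have hT2 : ∀ y ∉ T, u y ≤ τ := fun y hy => hT x0 hx0 y hy
  have hsplit : ∑ x ∈ T, u x + ∑ x ∈ Tᶜ, u x = ∑ x, u x := Finset.sum_add_sum_compl T u
  have hRnn : 0 ≤ ∑ x ∈ Tᶜ, u x := Finset.sum_nonneg fun x _ => hu x
  have hTnn : 0 ≤ ∑ x ∈ T, u x := Finset.sum_nonneg fun x _ => hu x
  have hτ1 : τ < 1 := by
    have : (T.card : ℝ) * τ ≤ ∑ x ∈ T, u x := by
      have := Finset.card_nsmul_le_sum T u τ hmin
      simpa using this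
    rw [hTc] at this
    by_contra hcon
    nlinarith
  have hτ0 : 0 ≤ τ := hu _
  set a := 1 - τ with ha
  have ha0 : 0 < a := by linarith
  set K : ℝ := (k:ℝ) - 1 with hK
  have hK0 : 0 < K := by
    have : (2:ℝ) ≤ k := by exact_mod_cast hk
    linarith
  have hm : ((Tᶜ).card : ℝ) = K * s := by
    rw [Finset.card_compl, hcard, hTc, Nat.cast_sub (by nlinarith)]
    push_cast; rw [hK]; ring
  set m : ℝ := K * s with hmdef
  have hm0 : 0 < m := by positivity
  set ρ : ℝ := r / K with hρ
  have hρK : ρ * K = r := by rw [hρ]; field_simp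
  have hρ1 : 1 ≤ 2 * ρ := by
    have : (k:ℝ) ≤ 2 * r + 1 := by exact_mod_cast h1
    by_contra hcon
    nlinarith
  have hρ2 : ρ ≤ 1 := by
    have : (r:ℝ) + 1 ≤ k := by exact_mod_cast h2
    rw [hρ, div_le_one hK0]; linarith
  set Q : Ω → (Fin r → Ω) → ℝ := fun x f' => if ∀ i, f' i ∉ T then
      (if x ∉ T then (if 1 - τ ≤ ∑ i, u (f' i) then u x else 0) else
        (if 1 ≤ u x + ∑ i, u (f' i) then 1 else 0) - 1) else 0 with hQ
  set P : Finset (Fin r → Ω) := Fintype.piFinset (fun _ => Tᶜ) with hP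
  have hPc : (P.card : ℝ) = m ^ r := by
    rw [hP, Fintype.card_piFinset]; simp [hm]
  -- inner sum
  have hinner : ∀ f' : Fin r → Ω, ∑ x, Q x f' ≤ if f' ∈ P then
      ∑ x ∈ T, (2 * ρ - 1 + 2 * (∑ i, u (f' i) - ρ * (1 - u x)) / a) else 0 := by
    intro f'
    have hmem : f' ∈ P ↔ ∀ i, f' i ∉ T := by simp [hP, Fintype.mem_piFinset]
    by_cases hf : ∀ i, f' i ∉ T
    · rw [if_pos (hmem.2 hf), ← Finset.sum_add_sum_compl T]
      have hA : ∑ x ∈ T, Q x f' =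
          ∑ x ∈ T, ((if 1 - u x ≤ ∑ i, u (f' i) then (1:ℝ) else 0) - 1) := by
        apply Finset.sum_congr rfl
        intro x hx
        simp only [hQ]
        rw [if_pos hf, if_neg (not_not.2 hx)]
        simp only [sub_le_iff_le_add']
      have hB : ∑ x ∈ Tᶜ, Q x f' ≤ ∑ x ∈ T, (if a ≤ ∑ i, u (f' i) then (1:ℝ) else 0) := by
        have : ∑ x ∈ Tᶜ, Q x f' = ∑ x ∈ Tᶜ, (if a ≤ ∑ i, u (f' i) then u x else 0) := by
          apply Finset.sum_congr rfl
          intro x hx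
          simp only [hQ]
          rw [if_pos hf, if_pos (by simpa using hx)]
        rw [this]
        split_ifs
        · simp [hTc]; linarith
        · simp
      rw [hA]
      refine (add_le_add_right hB _).trans ?_
      rw [← Finset.sum_add_distrib]
      apply Finset.sum_le_sum
      intro x hx
      have := pointwise a (∑ i, u (f' i)) (1 - u x) ρ ha0 (Finset.sum_nonneg fun i _ => hu _)
        (by have := hmin x hx; linarith) hρ1 hρ2
      linarith
    · rw [if_neg (fun h => hf (hmem.1 h))]
      apply le_of_eq
      apply Finset.sum_eq_zero
      intro x _
      simp only [hQ]
      rw [if_neg hf]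
  have hSS : m * ∑ f' ∈ P, ∑ i, u (f' i) = r * m ^ r * ∑ x ∈ Tᶜ, u x := by
    rw [Finset.sum_comm]
    simp only [hP, Fintype.sum_piFinset_apply, Finset.sum_const, Fintype.card_fin,
      Finset.card_univ, nsmul_eq_mul, Nat.cast_pow, hm]
    rcases r with _ | r
    · simp
    · simp only [Nat.add_sub_cancel]; ring
  have hcs : ∑ x ∈ Tᶜ, u x ≤ ∑ x ∈ T, (1 - u x) := by
    rw [Finset.sum_sub_distrib]; simp [hTc]; linarith
  have hQtot : ∑ f' : Fin r → Ω, ∑ x, Q x f' ≤ m ^ r * s * (2 * ρ - 1) := by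
    refine (Finset.sum_le_sum fun f' _ => hinner f').trans ?_
    rw [Finset.sum_ite_mem, Finset.univ_inter]
    have e1 : ∀ f' : Fin r → Ω,
      ∑ x ∈ T, (2 * ρ - 1 + 2 * (∑ i, u (f' i) - ρ * (1 - u x)) / a) =
        s * (2 * ρ - 1) + 2 / a * (s * ∑ i, u (f' i) - ρ * ∑ x ∈ T, (1 - u x)) := by
      intro f'
      rw [Finset.sum_add_distrib, ← Finset.sum_div, ← Finset.mul_sum,
        Finset.sum_sub_distrib (fun _ => ∑ i, u (f' i)) (fun x => ρ * (1 - u x)),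
        ← Finset.mul_sum]
      simp only [Finset.sum_const, hTc, nsmul_eq_mul]
      ring
    simp only [e1]
    rw [Finset.sum_add_distrib, ← Finset.mul_sum P (fun f' => s * ∑ i, u (f' i) - ρ * ∑ x ∈ T, (1 - u x)),
      Finset.sum_sub_distrib (fun f' : Fin r → Ω => s * ∑ i, u (f' i)),
      ← Finset.mul_sum P (fun f' => ∑ i, u (f' i))]
    simp only [Finset.sum_const, nsmul_eq_mul, hPc]
    have e2 : s * ∑ f' ∈ P, ∑ i, u (f' i) = m ^ r * ρ * ∑ x ∈ Tᶜ, u x := by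
      have : K * (s * ∑ f' ∈ P, ∑ i, u (f' i)) = K * (m ^ r * ρ * ∑ x ∈ Tᶜ, u x) := by
        rw [← mul_assoc, ← hmdef, hSS, ← hρK]; ring
      exact mul_left_cancel₀ hK0.ne' this
    rw [e2]
    have e3 : m ^ r * ρ * ∑ x ∈ Tᶜ, u x ≤ m ^ r * ρ * ∑ x ∈ T, (1 - u x) := by
      apply mul_le_mul_of_nonneg_left hcs
      have : 0 ≤ ρ := by linarith
      positivity
    have e4 : 2 / a * (m ^ r * ρ * ∑ x ∈ Tᶜ, u x - m ^ r * (ρ * ∑ x ∈ T, (1 - u x))) ≤ 0 := by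
      apply mul_nonpos_of_nonneg_of_nonpos (by positivity)
      linarith
    linarith
  calc _ ≤ ∑ f : Fin (r + 1) → Ω,
        (1 - (if ∀ i, f i ∉ T then (1:ℝ) else 0) + ∑ j, Q (f j) (j.removeNth f)) :=
        Finset.sum_le_sum fun f _ => pw2 u hu T τ hT2 Q hQ f
    _ = (k * s : ℝ) ^ (r+1) - m ^ (r+1) + (r + 1) * ∑ f' : Fin r → Ω, ∑ x, Q x f' := by
        rw [Finset.sum_add_distrib, Finset.sum_sub_distrib, Finset.sum_comm (s := Finset.univ (α := Fin (r+1) → Ω))]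
        simp only [sum_removeNth]
        have : ∑ f : Fin (r + 1) → Ω, (if ∀ i, f i ∉ T then (1:ℝ) else 0) = m ^ (r+1) := by
          have h : Finset.univ.filter (fun f : Fin (r + 1) → Ω => ∀ i, f i ∉ T) =
            Fintype.piFinset (fun _ => Tᶜ) := by ext; simp
          rw [Finset.sum_boole, h, Fintype.card_piFinset]
          simp [hm]
        rw [this]
        simp [hcard]
    _ ≤ (k * s : ℝ) ^ (r+1) - m ^ (r+1) + (r + 1) * (m ^ r * s * (2 * ρ - 1)) := by
        gcongr
    _ = _ := by
        have : (2 * r + 1 - k : ℝ) = K * (2 * ρ - 1) := by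
          have : (k:ℝ) = K + 1 := by rw [hK]; ring
          rw [this, ← hρK]; ring
        rw [this, pow_succ m r, hmdef]
        field_simp
        ring

open Finset in
lemma duality {n k : ℕ} (hk : 1 ≤ k) (hn : 1 ≤ n) (H : Finset (Finset (Fin n)))
    (hH : H ⊆ Finset.univ.powersetCard k)
    (hno : ¬ ∃ w : Finset (Fin n) → ℝ, ((∀ e, 0 ≤ w e ∧ w e ≤ 1) ∧ (∀ e ∉ H, w e = 0) ∧
      ∀ v : Fin n, ∑ e ∈ H.filter (fun e => v ∈ e), w e ≤ 1) ∧ ∑ e ∈ H, w e = (n : ℝ) / k) :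
    ∃ (y : Fin n → ℝ) (c : ℝ), (∀ e ∈ H, c ≤ ∑ v ∈ e, y v) ∧ ∑ v, y v < (n:ℝ) / k * c := by
  have hk0 : (0:ℝ) < k := by exact_mod_cast hk
  have hn0 : (0:ℝ) < n := by exact_mod_cast hn
  let L : (H → ℝ) →ₗ[ℝ] (Fin n → ℝ) :=
    { toFun := fun w v => ∑ e : H, w e * (if v ∈ e.1 then 1 else 0)
      map_add' := by intro a b; ext v; simp [add_mul, Finset.sum_add_distrib, -mul_ite]
      map_smul' := by intro a b; ext v; simp [mul_assoc, Finset.mul_sum, -mul_ite] }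
  have hconv : Convex ℝ (L '' stdSimplex ℝ H) := (convex_stdSimplex ℝ H).linear_image L
  have hclosed : IsClosed (L '' stdSimplex ℝ H) :=
    ((isCompact_stdSimplex ℝ H).image L.continuous_of_finiteDimensional).isClosed
  have hx : (fun _ => (k:ℝ) / n : Fin n → ℝ) ∉ L '' stdSimplex ℝ H := by
    rintro ⟨w, ⟨hw0, hw1⟩, hw⟩
    apply hno
    let W : Finset (Fin n) → ℝ := fun e => if h : e ∈ H then (n:ℝ) / k * w ⟨e, h⟩ else 0
    have hWH : ∀ F : Finset (Fin n) → ℝ, ∑ e ∈ H, W e * F e = n / k * ∑ e : H, w e * F e := by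
      intro F
      rw [← Finset.sum_coe_sort H, Finset.mul_sum]
      apply Finset.sum_congr rfl
      intro e _
      simp [W, mul_assoc]
    have hW0 : ∀ e, 0 ≤ W e := by
      intro e
      simp only [W]
      split_ifs with h
      · have := hw0 ⟨e, h⟩
        positivity
      · exact le_rfl
    have hv : ∀ v : Fin n, ∑ e ∈ H.filter (fun e => v ∈ e), W e = 1 := by
      intro v
      have h1 := congrFun hw v
      have h2 : ∑ e : H, w e * (if v ∈ e.1 then 1 else 0) = (k:ℝ) / n := h1
      rw [Finset.sum_filter]
      have h3 := hWH (fun e => if v ∈ e then 1 else 0)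
      rw [h2] at h3
      simp only [mul_ite, mul_one, mul_zero] at h3
      rw [h3]; field_simp
    refine ⟨W, ⟨fun e => ⟨hW0 e, ?_⟩, ?_, fun v => (hv v).le⟩, ?_⟩
    · by_cases h : e ∈ H
      · have hc := (Finset.mem_powersetCard.1 (hH h)).2
        have : e.Nonempty := by rw [← Finset.card_pos]; omega
        obtain ⟨v, hve⟩ := this
        rw [← hv v]
        exact Finset.single_le_sum (f := W) (fun e _ => hW0 e) (by simp [h, hve])
      · simp [W, h]
    · intro e h; simp [W, h]
    · have h3 := hWH (fun _ => 1)
      simp only [mul_one] at h3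
      rw [h3, hw1, mul_one]
  obtain ⟨f, c, hfx, hfb⟩ := geometric_hahn_banach_point_closed hconv hclosed hx
  have hf : ∀ x : Fin n → ℝ, f x = ∑ v, x v * f (Pi.single v 1) := by
    intro x
    have := LinearMap.pi_apply_eq_sum_univ f.toLinearMap x
    simp only [ContinuousLinearMap.coe_coe, smul_eq_mul] at this
    rw [this]
    apply Finset.sum_congr rfl
    intro i _
    congr 2
    ext j
    simp [Pi.single_apply, eq_comm]
  refine ⟨fun v => f (Pi.single v 1), c, ?_, ?_⟩
  · intro e he
    have h1 := hfb _ ⟨_, single_mem_stdSimplex ℝ (⟨e, he⟩ : H), rfl⟩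
    have h2 : L (Pi.single (⟨e, he⟩ : H) 1) = fun v => if v ∈ e then (1:ℝ) else 0 := by
      ext v
      show ∑ e' : H, _ = _
      rw [Finset.sum_eq_single ⟨e, he⟩]
      · simp
      · intro b _ hb; simp [hb]
      · simp
    rw [h2, hf] at h1
    simp at h1
    exact h1.le
  · rw [hf, ← Finset.mul_sum] at hfx
    rw [div_mul_eq_mul_div, lt_div_iff₀ hk0]
    rw [div_mul_eq_mul_div, div_lt_iff₀ hn0] at hfx
    linarith

lemma count {n l : ℕ} (L : Finset (Finset (Fin n))) (hL : ∀ e ∈ L, e.card = l)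
    (p : (Fin l → Fin n) → Prop) [DecidablePred p]
    (hp : ∀ f, Function.Injective f → Finset.univ.image f ∈ L → p f) :
    l.factorial * L.card ≤ (Finset.univ.filter p).card := by
  classical
  have h1 : ∀ e ∈ L, l.factorial ≤ ((Finset.univ.filter
      (fun f : Fin l → Fin n => p f ∧ Finset.univ.image f = e))).card := by
    intro e he
    have hc : Fintype.card (Fin l ≃ e) = l.factorial := by
      rw [Fintype.card_equiv (Fintype.equivOfCardEq (by simp [hL e he]))]; simp
    rw [← hc, ← Finset.card_univ]
    apply Finset.card_le_card_of_injOn (fun σ i => ((σ i : e) : Fin n))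
    · intro σ _
      have him : Finset.univ.image (fun i => ((σ i : e) : Fin n)) = e := by
        ext x
        simp only [Finset.mem_image, Finset.mem_univ, true_and]
        constructor
        · rintro ⟨i, rfl⟩; exact (σ i).2
        · intro hx; exact ⟨σ.symm ⟨x, hx⟩, by simp⟩
      simp only [Finset.coe_filter, Set.mem_ofPred_eq, Finset.mem_univ, true_and]
      refine ⟨hp _ ?_ (by rw [him]; exact he), him⟩
      exact Subtype.val_injective.comp σ.injective
    · intro σ _ σ' _ h
      ext i
      exact congrArg Fin.val (congrFun h i)
  have h2 : (L.biUnion fun e => Finset.univ.filter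
      (fun f : Fin l → Fin n => p f ∧ Finset.univ.image f = e)).card =
      ∑ e ∈ L, (Finset.univ.filter
      (fun f : Fin l → Fin n => p f ∧ Finset.univ.image f = e)).card := by
    apply Finset.card_biUnion
    intro e _ e' _ hne
    rw [Function.onFun, Finset.disjoint_left]
    intro f hf hf'
    simp at hf hf'
    exact hne (hf.2.symm.trans hf'.2)
  calc l.factorial * L.card = ∑ e ∈ L, l.factorial := by simp [mul_comm]
    _ ≤ _ := Finset.sum_le_sum h1
    _ = _ := h2.symm
    _ ≤ _ := by
      apply Finset.card_le_card
      intro f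
      simp

lemma analytic (g ε : ℝ) (k l : ℕ) (hε : 0 < ε) :
    ∃ n₀ : ℕ, ∀ n : ℕ, n₀ ≤ n → g * (n:ℝ) ^ l < (g + ε) * ((n:ℝ) - k) ^ l := by
  have h1 : Filter.Tendsto (fun n : ℕ => (g + ε) * (1 - (k:ℝ) / n) ^ l) Filter.atTop
      (nhds ((g + ε) * (1 - 0) ^ l)) :=
    ((tendsto_const_nhds.sub (tendsto_const_div_atTop_nhds_zero_nat (k:ℝ))).pow l).const_mul _
  have h2 : ∀ᶠ n : ℕ in Filter.atTop, g < (g + ε) * (1 - (k:ℝ) / n) ^ l :=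
    h1.eventually (lt_mem_nhds (by simp; linarith))
  obtain ⟨N, hN⟩ := Filter.eventually_atTop.1 h2
  refine ⟨max N 1, fun n hn => ?_⟩
  have hn0 : (0:ℝ) < n := by
    have : 1 ≤ n := le_trans (le_max_right _ _) hn
    exact_mod_cast this
  have h3 := hN n (le_trans (le_max_left _ _) hn)
  have h4 : ((n:ℝ) - k) = n * (1 - k / n) := by field_simp
  rw [h4, mul_pow]
  have : 0 < (n:ℝ) ^ l := by positivity
  nlinarith

lemma main_lemma (k d n : ℕ) (hk : 3 ≤ k) (hd : 1 ≤ d) (hdk : 2 * d < k) (hn : k ≤ n)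
    (u : Fin n → ℝ) (hu : ∀ v, 0 ≤ u v) (hsum : ∑ v, u v < (n:ℝ) / k) :
    ((Finset.univ.filter (fun f : Fin (k - d) → Fin n => 1 ≤ ∑ i, u (f i))).card : ℝ) ≤
      ((1 : ℝ) - (1 - ((k : ℝ) - d) * ((k : ℝ) - 2 * d - 1) / ((k : ℝ) - 1) ^ 2) *
              (1 - 1 / (k : ℝ)) ^ (k - d)) * (n:ℝ) ^ (k - d) := by
  obtain ⟨r, hr⟩ : ∃ r, k - d = r + 1 := ⟨k - d - 1, by omega⟩
  have hk0 : (0:ℝ) < k := by exact_mod_cast (by omega : 0 < k)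
  rw [hr]
  have hdr : (d:ℝ) = k - r - 1 := by
    have : k = d + r + 1 := by omega
    rw [this]; push_cast; ring
  have h := key (Ω := Fin n × Fin k) k r n (by omega) (by omega) (by omega)
    (by simp [mul_comm]) (fun x => u x.1) (fun x => hu _) (by
      rw [Fintype.sum_prod_type]
      simp only [Finset.sum_const, Finset.card_univ, Fintype.card_fin, nsmul_eq_mul]
      rw [← Finset.mul_sum]
      rw [lt_div_iff₀ hk0] at hsum
      linarith)
  have h' : ∑ f : Fin (r + 1) → Fin n × Fin k, (if 1 ≤ ∑ i, u (f i).1 then (1:ℝ) else 0) =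
      (k:ℝ) ^ (r + 1) *
        ((Finset.univ.filter (fun f : Fin (r + 1) → Fin n => 1 ≤ ∑ i, u (f i))).card : ℝ) := by
    rw [← (Equiv.arrowProdEquivProdArrow (Fin (r+1)) (fun _ => Fin n) (fun _ => Fin k)).symm.sum_comp,
      Fintype.sum_prod_type]
    rw [← Finset.sum_boole, Finset.mul_sum]
    apply Finset.sum_congr rfl
    intro x _
    by_cases hx : 1 ≤ ∑ i, u (x i) <;> simp [Equiv.arrowProdEquivProdArrow, hx]
  rw [h'] at h
  have e : ((1 : ℝ) - (1 - ((k : ℝ) - d) * ((k : ℝ) - 2 * d - 1) / ((k : ℝ) - 1) ^ 2) *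
              (1 - 1 / (k : ℝ)) ^ (r + 1)) * (n:ℝ) ^ (r + 1) =
      (((k:ℝ) * n) ^ (r + 1) - (((k:ℝ) - 1) * n) ^ (r + 1) *
        (1 - ((r:ℝ) + 1) * (2 * r + 1 - k) / ((k:ℝ) - 1) ^ 2)) / (k:ℝ) ^ (r + 1) := by
    have e1 : (1 - 1 / (k:ℝ)) = (k - 1) / k := by field_simp
    have e2 : ((k : ℝ) - d) * ((k : ℝ) - 2 * d - 1) = ((r:ℝ) + 1) * (2 * r + 1 - k) := by
      rw [hdr]; ring
    rw [e1, e2, div_pow, mul_pow, mul_pow]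
    generalize 1 - ((r:ℝ) + 1) * (2 * r + 1 - k) / ((k:ℝ) - 1) ^ 2 = q
    have : (k:ℝ) ^ (r + 1) ≠ 0 := by positivity
    field_simp
  rw [e, le_div_iff₀ (by positivity)]
  linarith

/-- Theorem 1.6: for `k ≥ 3`, `1 ≤ d < k/2` and
`g(k,d) = 1 - (1 - (k-d)(k-2d-1)/(k-1)²)(1 - 1/k)^{k-d}`, every sufficiently large `n`-vertex
`k`-graph with minimum `d`-degree at least `(g(k,d) + ε)·C(n-d,k-d)` has a perfect fractional
matching (one of size `n/k`). -/
theorem stmt_1 (k d : ℕ) (hk : 3 ≤ k) (hd : 1 ≤ d) (hdk : 2 * d < k)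
    (ε : ℝ) (hε : 0 < ε) :
    ∃ n₀ : ℕ, ∀ n : ℕ, n₀ ≤ n →
      ∀ H : Finset (Finset (Fin n)), H ⊆ Finset.univ.powersetCard k →
        (∀ S : Finset (Fin n), S.card = d →
          ((1 : ℝ) - (1 - ((k : ℝ) - d) * ((k : ℝ) - 2 * d - 1) / ((k : ℝ) - 1) ^ 2) *
              (1 - 1 / (k : ℝ)) ^ (k - d) + ε) * ((n - d).choose (k - d) : ℝ) ≤
            ((H.filter fun e => S ⊆ e).card : ℝ)) →
        ∃ w : Finset (Fin n) → ℝ, IsFracMatching H w ∧ ∑ e ∈ H, w e = (n : ℝ) / k := by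
  have hk0 : (0:ℝ) < k := by exact_mod_cast (by omega : 0 < k)
  have hg0 : 0 ≤ (1 : ℝ) - (1 - ((k : ℝ) - d) * ((k : ℝ) - 2 * d - 1) / ((k : ℝ) - 1) ^ 2) *
              (1 - 1 / (k : ℝ)) ^ (k - d) := by
    have hkd : 2 * (d:ℝ) + 1 ≤ k := by exact_mod_cast hdk
    have hd0 : (0:ℝ) ≤ d := by positivity
    have h1 : 0 ≤ ((k : ℝ) - d) * ((k : ℝ) - 2 * d - 1) / ((k : ℝ) - 1) ^ 2 := by
      apply div_nonneg _ (sq_nonneg _)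
      apply mul_nonneg <;> linarith
    have h2 : 1 / (k:ℝ) ≤ 1 := by
      rw [div_le_one hk0]; linarith
    have h3 : 0 ≤ 1 / (k:ℝ) := by positivity
    have h4 : (1 - 1 / (k : ℝ)) ^ (k - d) ≤ 1 := pow_le_one₀ (by linarith) (by linarith)
    have h5 : 0 ≤ (1 - 1 / (k : ℝ)) ^ (k - d) := pow_nonneg (by linarith) _
    nlinarith
  have hmain := main_lemma k d
  generalize hg : (1 : ℝ) - (1 - ((k : ℝ) - d) * ((k : ℝ) - 2 * d - 1) / ((k : ℝ) - 1) ^ 2) *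
              (1 - 1 / (k : ℝ)) ^ (k - d) = g at hg0 hmain ⊢
  obtain ⟨n₁, hn₁⟩ := analytic g ε k (k - d) hε
  refine ⟨max n₁ k, fun n hn H hH hdeg => ?_⟩
  have hnk : k ≤ n := le_trans (le_max_right _ _) hn
  have hnk' : (k:ℝ) ≤ n := by exact_mod_cast hnk
  by_contra hno
  obtain ⟨y, c, hyc, hys⟩ := duality (by omega) (by omega) H hH hno
  obtain ⟨S, hSc, hS⟩ := exists_top (fun v => - y v) d (by simp; omega)
  have hSne : S.Nonempty := by rw [← Finset.card_pos]; omega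
  obtain ⟨x0, hx0, hmax⟩ := Finset.exists_max_image S y hSne
  set t := y x0 with ht
  have hout : ∀ v ∉ S, t ≤ y v := fun v hv => by
    have := hS x0 hx0 v hv
    linarith
  set δ : ℝ := d * t - ∑ v ∈ S, y v with hδ
  have hδ0 : 0 ≤ δ := by
    have := Finset.sum_le_card_nsmul S y t hmax
    rw [hSc, nsmul_eq_mul] at this
    linarith
  set θ : ℝ := c - k * t + δ with hθ
  have hsplit : ∑ v ∈ S, y v + ∑ v ∈ Sᶜ, y v = ∑ v, y v := Finset.sum_add_sum_compl S y
  have hScc : ((Sᶜ).card : ℝ) = n - d := by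
    rw [Finset.card_compl, hSc, Fintype.card_fin, Nat.cast_sub (by omega)]
  have hU : ∑ v ∈ Sᶜ, (y v - t) < n / k * θ := by
    rw [Finset.sum_sub_distrib]
    simp only [Finset.sum_const, nsmul_eq_mul, hScc]
    have h1 : (1:ℝ) ≤ n / k := by rw [le_div_iff₀ hk0]; linarith
    have h2 : (n:ℝ) / k * θ = n / k * c - n * t + n / k * δ := by
      rw [hθ]; field_simp
    rw [h2]
    nlinarith
  have hU0 : 0 ≤ ∑ v ∈ Sᶜ, (y v - t) :=
    Finset.sum_nonneg fun v hv => sub_nonneg.2 (hout v (by simpa using hv))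
  have hθ0 : 0 < θ := by
    have h1 : 0 < (n:ℝ) / k * θ := lt_of_le_of_lt hU0 hU
    have h2 : 0 < (n:ℝ) / k := div_pos (by linarith) hk0
    exact (mul_pos_iff_of_pos_left h2).1 h1
  set u : Fin n → ℝ := fun v => if v ∈ S then 0 else (y v - t) / θ with hu
  have hu0 : ∀ v, 0 ≤ u v := by
    intro v
    simp only [hu]
    split_ifs with h
    · exact le_rfl
    · exact div_nonneg (sub_nonneg.2 (hout v h)) hθ0.le
  have hus : ∑ v, u v < (n:ℝ) / k := by
    have h1 : ∑ v, u v = (∑ v ∈ Sᶜ, (y v - t)) / θ := by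
      rw [← Finset.sum_add_sum_compl S u, Finset.sum_div]
      rw [Finset.sum_eq_zero (fun v hv => by simp [hu, hv]), zero_add]
      apply Finset.sum_congr rfl
      intro v hv
      have : v ∉ S := by simpa using hv
      simp [hu, this]
    rw [h1, div_lt_iff₀ hθ0]
    exact hU
  set L : Finset (Finset (Fin n)) := (H.filter fun e => S ⊆ e).image (fun e => e \ S) with hL
  have hLc : L.card = (H.filter fun e => S ⊆ e).card := by
    apply Finset.card_image_of_injOn
    intro e he e' he' h
    have h1 : S ⊆ e := by simp at he; exact he.2
    have h2 : S ⊆ e' := by simp at he'; exact he'.2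
    simp only at h
    rw [← Finset.sdiff_union_of_subset h1, h, Finset.sdiff_union_of_subset h2]
  have hLmem : ∀ e ∈ L, e.card = k - d ∧ 1 ≤ ∑ v ∈ e, u v := by
    intro e' he'
    obtain ⟨e, he, rfl⟩ := Finset.mem_image.1 he'
    obtain ⟨heH, hSe⟩ := Finset.mem_filter.1 he
    have hec := (Finset.mem_powersetCard.1 (hH heH)).2
    have hcard : (e \ S).card = k - d := by
      rw [Finset.card_sdiff_of_subset hSe, hec, hSc]
    refine ⟨hcard, ?_⟩
    have h1 : ∑ v ∈ e \ S, u v = (∑ v ∈ e \ S, (y v - t)) / θ := by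
      rw [Finset.sum_div]
      apply Finset.sum_congr rfl
      intro v hv
      simp [hu, (Finset.mem_sdiff.1 hv).2]
    rw [h1, le_div_iff₀ hθ0, Finset.sum_sub_distrib]
    simp only [Finset.sum_const, nsmul_eq_mul, hcard]
    rw [Nat.cast_sub (by omega)]
    have h2 := hyc e heH
    have h3 := Finset.sum_sdiff hSe (f := y)
    linarith
  have hcount := count L (fun e he => (hLmem e he).1)
    (fun f : Fin (k - d) → Fin n => 1 ≤ ∑ i, u (f i)) (by
      intro f hf hfL
      have := (hLmem _ hfL).2
      rwa [Finset.sum_image (fun a _ b _ h => hf h)] at this)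
  have hub := hmain n hk hd hdk hnk u hu0 hus
  have hlow := hdeg S hSc
  rw [← hLc] at hlow
  have hstrict := hn₁ n (le_trans (le_max_left _ _) hn)
  have hdesc : ((n:ℝ) - k) ^ (k - d) ≤ (k - d).factorial * ((n - d).choose (k - d) : ℝ) := by
    have h1 : (n - k) ^ (k - d) ≤ (k - d).factorial * (n - d).choose (k - d) := by
      rw [← Nat.descFactorial_eq_factorial_mul_choose]
      refine le_trans (Nat.pow_le_pow_left ?_ _) (Nat.pow_sub_le_descFactorial _ _)
      omega
    have h2 : ((n - k : ℕ) : ℝ) = n - k := Nat.cast_sub hnk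
    rw [← h2]
    exact_mod_cast h1
  have hcount' := (Nat.cast_le (α := ℝ)).2 hcount
  rw [Nat.cast_mul] at hcount'
  have h1 : (g + ε) * ((n:ℝ) - k) ^ (k - d) ≤
      (g + ε) * ((k - d).factorial * ((n - d).choose (k - d) : ℝ)) :=
    mul_le_mul_of_nonneg_left hdesc (by linarith)
  have h2 : ((k - d).factorial : ℝ) * ((g + ε) * ((n - d).choose (k - d) : ℝ)) ≤
      (k - d).factorial * (L.card : ℝ) :=
    mul_le_mul_of_nonneg_left hlow (by positivity)
  linarith
end

section
/- Let k and d be integers with 1 ≤ d < k/2. Then for every ε > 0 there exists n₀ such that for all n ≥ n₀ with k dividing n, every k-uniform hypergraph H on n vertices with δ_d(H) ≥ ((k−d)/k − (k−d−1)/k^{k−d} + ε)·C(n−d, k−d) contains a perfect matching. -/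
/-- `H` has a perfect matching: a set of pairwise disjoint edges covering all vertices. -/
def HasPerfectMatching {n : ℕ} (H : Finset (Finset (Fin n))) : Prop :=
  ∃ M ⊆ H, (M : Set (Finset (Fin n))).PairwiseDisjoint id ∧ M.biUnion id = Finset.univ

section MR
open Finset

theorem mr_excess (m k : ℕ) [NeZero k] (hm : 2 ≤ m) (hmk : m < k)
    (y : Fin m → Fin k → ℝ) (hy0 : ∀ i c, 0 ≤ y i c) (hy1 : ∀ i, ∑ c, y i c = 1)
    (F : Finset (Fin m → Fin k)) (hF : ∀ x ∈ F, 1 ≤ ∑ i, y i (x i)) :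
    F.card + (m - 1) ≤ m * k ^ (m - 1) := by
  classical
  set s : (Fin m → Fin k) → ℝ := fun x => ∑ i, y i (x i) with hs
  set G : Finset (Fin m → Fin k) := univ.filter (fun x => 1 ≤ s x) with hG
  have hFG : F.card ≤ G.card := card_le_card (fun x hx => by simp [hG]; exact hF x hx)
  by_contra hcon
  have hGc : m * k ^ (m - 1) + 2 ≤ G.card + m := by omega
  set f : (Fin m → Fin k) → ℝ := fun x => s x - (if 1 ≤ s x then 1 else 0) with hf
  have hs0 : ∀ x, 0 ≤ s x := fun x => sum_nonneg (fun i _ => hy0 i _)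
  have hf0 : ∀ x, 0 ≤ f x := by
    intro x
    simp only [hf]
    split_ifs with h
    · linarith
    · linarith [hs0 x]
  have hkpos : (0 : ℝ) < k := by
    have : 0 < k := by omega
    exact_mod_cast this
  -- translation classes
  have hclass : ∀ a : Fin m → Fin k, ∑ t : Fin k, s (fun i => a i + t) = m := by
    intro a
    simp only [hs]
    rw [sum_comm]
    have : ∀ i, ∑ t : Fin k, y i (a i + t) = 1 := by
      intro i
      rw [← hy1 i]
      exact Equiv.sum_comp (Equiv.addLeft (a i)) (y i)
    simp [this]
  have hshift : ∀ (h : (Fin m → Fin k) → ℝ) (t : Fin k),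
      ∑ a : Fin m → Fin k, h (fun i => a i + t) = ∑ a, h a := by
    intro h t
    exact Equiv.sum_comp (Equiv.addRight (fun _ : Fin m => t)) h
  have hstot : (k : ℝ) * ∑ x, s x = m * (k : ℝ) ^ m := by
    have h1 : ∑ a : Fin m → Fin k, ∑ t : Fin k, s (fun i => a i + t) = m * (k : ℝ) ^ m := by
      simp [hclass, mul_comm]
    rw [sum_comm] at h1
    simp only [hshift] at h1
    simpa using h1
  have hstot' : ∑ x, s x = m * (k : ℝ) ^ (m - 1) := by
    have : (k : ℝ) ^ m = k * (k : ℝ) ^ (m - 1) := by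
      rw [← pow_succ']; congr 1; omega
    rw [this] at hstot
    have := mul_left_cancel₀ hkpos.ne' (hstot.trans (by ring : _ = (k : ℝ) * (m * (k : ℝ) ^ (m - 1))))
    exact this
  have hftot : ∑ x, f x ≤ (m : ℝ) - 2 := by
    have : ∑ x, f x = ∑ x, s x - G.card := by
      simp only [hf, sum_sub_distrib]
      congr 1
      simp [hG]
    rw [this, hstot']
    have : ((m * k ^ (m - 1) + 2 : ℕ) : ℝ) ≤ ((G.card + m : ℕ) : ℝ) := by exact_mod_cast hGc
    push_cast at this
    linarith
  have hgint : ∀ a, f a ≠ 0 → 1 ≤ ∑ t : Fin k, f (fun i => a i + t) := by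
    intro a ha
    have hpos : 0 < ∑ t : Fin k, f (fun i => a i + t) := by
      have h1 : f a ≤ ∑ t : Fin k, f (fun i => a i + t) := by
        have := single_le_sum (f := fun t : Fin k => f (fun i => a i + t))
          (fun t _ => hf0 _) (mem_univ 0)
        simpa using this
      exact lt_of_lt_of_le (lt_of_le_of_ne (hf0 a) (Ne.symm ha)) h1
    have he : ∑ t : Fin k, f (fun i => a i + t)
        = ((m : ℤ) - ((univ.filter (fun t : Fin k => 1 ≤ s (fun i => a i + t))).card : ℤ) : ℤ) := by
      simp only [hf, sum_sub_distrib, hclass]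
      simp
    rw [he] at hpos ⊢
    have : (0 : ℤ) < ((m : ℤ) - ((univ.filter (fun t : Fin k => 1 ≤ s (fun i => a i + t))).card : ℤ) : ℤ) := by
      exact_mod_cast hpos
    exact_mod_cast this
  set B : Finset (Fin m → Fin k) := univ.filter (fun a => f a ≠ 0) with hB
  have hBc : B.card + 2 * k ≤ k * m := by
    have h1 : (B.card : ℝ) ≤ ∑ a : Fin m → Fin k, ∑ t : Fin k, f (fun i => a i + t) := by
      calc (B.card : ℝ) = ∑ a ∈ B, (1 : ℝ) := by simp
        _ ≤ ∑ a ∈ B, ∑ t : Fin k, f (fun i => a i + t) :=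
            sum_le_sum (fun a ha => hgint a (by simpa [hB] using ha))
        _ ≤ _ := sum_le_sum_of_subset_of_nonneg (subset_univ _)
            (fun a _ _ => sum_nonneg (fun t _ => hf0 _))
    rw [sum_comm] at h1
    simp only [hshift] at h1
    simp only [sum_const, card_univ, Fintype.card_fin, nsmul_eq_mul] at h1
    have h2 : (B.card : ℝ) ≤ k * ((m : ℝ) - 2) :=
      h1.trans (mul_le_mul_of_nonneg_left hftot hkpos.le)
    have h3 : ((B.card + 2 * k : ℕ) : ℝ) ≤ ((k * m : ℕ) : ℝ) := by push_cast; linarith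
    exact_mod_cast h3
  have hgoodline : ∀ i : Fin m, ∃ a : Fin m → Fin k, ∀ c, f (Function.update a i c) = 0 := by
    intro i
    by_contra hno
    push Not at hno
    have hsurj : (univ : Finset (Fin m → Fin k)) ⊆
        (B ×ˢ (univ : Finset (Fin k))).image (fun p => Function.update p.1 i p.2) := by
      intro a _
      obtain ⟨c, hc⟩ := hno a
      rw [mem_image]
      refine ⟨(Function.update a i c, a i), ?_, ?_⟩
      · simp [hB, hc]
      · simp
    have h1 := (card_le_card hsurj).trans card_image_le
    simp only [card_univ, Fintype.card_fun, Fintype.card_fin, card_product] at h1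
    obtain ⟨m', rfl⟩ : ∃ m', m = m' + 2 := ⟨m - 2, by omega⟩
    have h2 : m' < k ^ m' := Nat.lt_pow_self (by omega)
    have h3 : B.card ≤ k * m' := by nlinarith
    have h4 : k ^ (m' + 2) ≤ k * m' * k := h1.trans (Nat.mul_le_mul_right _ h3)
    have h5 : k ^ (m' + 2) = k * k ^ m' * k := by ring
    rw [h5] at h4
    have hk0 : 0 < k := by omega
    have h6 := Nat.le_of_mul_le_mul_right h4 hk0
    have h7 := Nat.le_of_mul_le_mul_left h6 hk0
    omega
  have hfz : ∀ x, f x = 0 → s x = 0 ∨ s x = 1 := by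
    intro x hx
    simp only [hf] at hx
    split_ifs at hx with h
    · right; linarith
    · left; linarith
  have hdich : ∀ i : Fin m, (∀ c, y i c = 1 / k) ∨ (∀ c, y i c = 0 ∨ y i c = 1) := by
    intro i
    obtain ⟨a, ha⟩ := hgoodline i
    set b := ∑ j ∈ univ.erase i, y j (a j) with hb
    have hb0 : 0 ≤ b := sum_nonneg (fun j _ => hy0 _ _)
    have hsc : ∀ c, s (Function.update a i c) = y i c + b := by
      intro c
      simp only [hs]
      rw [← add_sum_erase _ _ (mem_univ i)]
      congr 1
      · simp
      · apply sum_congr rfl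
        intro j hj
        rw [Function.update_of_ne (ne_of_mem_erase hj)]
    rcases hb0.eq_or_lt with h | h
    · right
      intro c
      have := hfz _ (ha c)
      rw [hsc, ← h, add_zero] at this
      exact this
    · left
      have hc1 : ∀ c, y i c = 1 - b := by
        intro c
        have := hfz _ (ha c)
        rw [hsc] at this
        rcases this with h' | h'
        · linarith [hy0 i c]
        · linarith
      have := hy1 i
      simp only [hc1, sum_const, card_univ, Fintype.card_fin, nsmul_eq_mul] at this
      intro c
      rw [hc1 c, eq_div_iff hkpos.ne']
      linarith
  by_cases hall : ∀ i, ∀ c, y i c = 0 ∨ y i c = 1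
  · have hex : ∀ i, ∃ c, y i c = 1 := by
      intro i
      by_contra hno
      push Not at hno
      have : ∀ c, y i c = 0 := fun c => (hall i c).resolve_right (hno c)
      have h1 := hy1 i
      simp [this] at h1
    choose c hc using hex
    have h1 : s c = m := by simp [hs, hc]
    have h2 : f c = m - 1 := by
      simp only [hf, h1]
      rw [if_pos]
      exact_mod_cast (by omega : 1 ≤ m)
    have h3 : f c ≤ ∑ x, f x := single_le_sum (fun x _ => hf0 x) (mem_univ c)
    linarith
  · push Not at hall
    obtain ⟨i0, c0, hc0, hc0'⟩ := hall
    have hu : ∀ c, y i0 c = 1 / k := by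
      rcases hdich i0 with h | h
      · exact h
      · rcases h c0 with h | h
        · exact absurd h hc0
        · exact absurd h hc0'
    obtain ⟨a, ha⟩ := hgoodline i0
    have hx := hfz _ (ha c0)
    set x := Function.update a i0 c0 with hxdef
    have hkinv : (0 : ℝ) < 1 / k := by positivity
    have hk1 : (1 : ℝ) / k < 1 := by
      rw [div_lt_one hkpos]
      exact_mod_cast (by omega : 1 < k)
    have hsx : 0 < s x := by
      have : y i0 (x i0) ≤ s x := single_le_sum (f := fun i => y i (x i)) (fun i _ => hy0 i _) (mem_univ i0)
      rw [hu] at this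
      linarith
    have hsx1 : s x = 1 := hx.resolve_left hsx.ne'
    by_cases hj : ∃ j, y j (x j) = 1
    · obtain ⟨j, hj⟩ := hj
      have hne : j ≠ i0 := by
        rintro rfl
        rw [hu] at hj
        linarith
      have : y j (x j) + y i0 (x i0) ≤ s x := by
        rw [← sum_pair (f := fun i => y i (x i)) hne]
        exact sum_le_sum_of_subset_of_nonneg (subset_univ _) (fun i _ _ => hy0 i _)
      rw [hj, hu] at this
      linarith
    · push Not at hj
      have hle : ∀ j, y j (x j) ≤ 1 / k := by
        intro j
        rcases hdich j with h | h
        · exact (h _).le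
        · rw [(h (x j)).resolve_right (hj j)]; exact hkinv.le
      have : s x ≤ ∑ j : Fin m, (1 : ℝ) / k := sum_le_sum (fun j _ => hle j)
      simp only [sum_const, card_univ, Fintype.card_fin, nsmul_eq_mul] at this
      have h2 : (m : ℝ) * (1 / k) < 1 := by
        rw [mul_one_div, div_lt_one hkpos]
        exact_mod_cast hmk
      linarith

theorem mr_minimax (m k : ℕ) [NeZero k] (F : Finset (Fin m → Fin k))
    (hno : ¬ ∃ y : Fin m → Fin k → ℝ, (∀ i c, 0 ≤ y i c) ∧ (∀ i, ∑ c, y i c = 1) ∧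
      ∀ x ∈ F, 1 ≤ ∑ i, y i (x i)) :
    ∃ (w : (Fin m → Fin k) → ℝ) (t : Fin m → ℝ), (∀ x, 0 ≤ w x) ∧ (∀ i, 0 ≤ t i) ∧
      (∀ i c, ∑ x ∈ F with x i = c, w x ≤ t i) ∧ ∑ i, t i < ∑ x ∈ F, w x := by
  classical
  let A : (Fin m → Fin k → ℝ) →ₗ[ℝ] (F → ℝ) :=
    { toFun := fun y x => ∑ i, y i (x.1 i)
      map_add' := by intro y z; ext x; simp [sum_add_distrib]
      map_smul' := by intro r y; ext x; simp [mul_sum] }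
  let K : Set (Fin m → Fin k → ℝ) := Set.pi Set.univ (fun _ => stdSimplex ℝ (Fin k))
  have hKc : IsCompact K := isCompact_univ_pi (fun _ => isCompact_stdSimplex ℝ (Fin k))
  have hKv : Convex ℝ K := convex_pi (fun _ _ => convex_stdSimplex ℝ (Fin k))
  have hAc : Continuous A := A.continuous_of_finiteDimensional
  have hdisj : Disjoint (A '' K) (Set.Ici (1 : F → ℝ)) := by
    rw [Set.disjoint_left]
    rintro z ⟨y, hy, rfl⟩ hz
    apply hno
    refine ⟨y, fun i c => (hy i trivial).1 c, fun i => (hy i trivial).2, fun x hx => ?_⟩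
    exact hz ⟨x, hx⟩
  obtain ⟨f, u, v, hfu, huv, hfv⟩ := geometric_hahn_banach_compact_closed
    (hKv.linear_image A) (hKc.image hAc) (convex_Ici (1 : F → ℝ)) isClosed_Ici hdisj
  let w0 : F → ℝ := fun x => f (Pi.single x 1)
  have hfsum : ∀ z : F → ℝ, f z = ∑ x, z x * w0 x := by
    intro z
    conv_lhs => rw [pi_eq_sum_univ' z]
    rw [map_sum]
    apply sum_congr rfl
    intro x _
    rw [map_smul, smul_eq_mul]
  have hw0 : ∀ x, 0 ≤ w0 x := by
    intro x
    by_contra hneg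
    push Not at hneg
    set S := f 1 with hS
    have h1 : v < S := hfv 1 (Set.mem_Ici.2 le_rfl)
    have h2 := hfv (1 + ((S - v) / (- w0 x)) • Pi.single x 1) (by
      rw [Set.mem_Ici]
      apply le_add_of_nonneg_right
      apply smul_nonneg
      · apply div_nonneg <;> linarith
      · exact Pi.single_nonneg.2 zero_le_one)
    rw [map_add, map_smul, smul_eq_mul] at h2
    change v < S + (S - v) / (- w0 x) * w0 x at h2
    have : (S - v) / (- w0 x) * w0 x = - (S - v) := by
      have hne : w0 x ≠ 0 := hneg.ne
      field_simp
    rw [this] at h2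
    linarith
  let w : (Fin m → Fin k) → ℝ := fun x => if h : x ∈ F then w0 ⟨x, h⟩ else 0
  have hw : ∀ x, 0 ≤ w x := by
    intro x; simp only [w]; split_ifs
    · exact hw0 _
    · exact le_rfl
  let W : Fin m → Fin k → ℝ := fun i c => ∑ x ∈ F with x i = c, w x
  have hmax : ∀ i, ∃ c, ∀ c', W i c' ≤ W i c := fun i => Finite.exists_max (W i)
  choose c hc using hmax
  refine ⟨w, fun i => W i (c i), hw, fun i => sum_nonneg (fun x _ => hw x), fun i c' => hc i c', ?_⟩
  have h1 : f 1 = ∑ x ∈ F, w x := by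
    rw [hfsum, ← sum_coe_sort F w]
    apply sum_congr rfl
    intro x _
    simp [w]
  have h2 := hfu (A (fun i => Pi.single (c i) 1)) ⟨_, fun i _ => single_mem_stdSimplex ℝ (c i), rfl⟩
  have h3 : f (A (fun i => Pi.single (c i) 1)) = ∑ i, W i (c i) := by
    rw [hfsum]
    have : ∀ x : F, A (fun i => Pi.single (c i) 1) x * w0 x = 
        ∑ i, if x.1 i = c i then w x.1 else 0 := by
      intro x
      simp only [A, LinearMap.coe_mk, AddHom.coe_mk, sum_mul]
      apply sum_congr rfl
      intro i _
      by_cases h : x.1 i = c i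
      · simp [h, w]
      · simp [h, Pi.single_apply]
    simp only [this]
    rw [sum_comm]
    apply sum_congr rfl
    intro i _
    simp only [W]
    rw [sum_filter, ← sum_coe_sort F]
  have h4 := hfv 1 (Set.mem_Ici.2 le_rfl)
  rw [h3] at h2
  rw [h1] at h4
  linarith

theorem mr_weights (m k : ℕ) (hm : 2 ≤ m) (hmk : m < k) (F : Finset (Fin m → Fin k))
    (hF : m * k ^ (m - 1) < F.card + (m - 1)) :
    ∃ (w : (Fin m → Fin k) → ℕ) (t : Fin m → ℕ),
      (∀ i c, ∑ x ∈ F with x i = c, w x ≤ t i) ∧ ∑ i, t i < ∑ x ∈ F, w x := by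
  haveI : NeZero k := ⟨by omega⟩
  obtain ⟨w, t, hw, ht, hwt, hlt⟩ := mr_minimax m k F (by
    rintro ⟨y, h0, h1, h2⟩
    have := mr_excess m k hm hmk y h0 h1 F h2
    omega)
  set D := ∑ x ∈ F, w x - ∑ i, t i with hD
  have hDpos : 0 < D := by linarith
  obtain ⟨N, hN⟩ := exists_nat_gt ((F.card + m : ℝ) / D)
  rw [div_lt_iff₀ hDpos] at hN
  refine ⟨fun x => ⌊N * w x⌋₊, fun i => ⌈N * t i⌉₊, ?_, ?_⟩
  · intro i c
    have h1 : ((∑ x ∈ F with x i = c, ⌊N * w x⌋₊ : ℕ) : ℝ) ≤ (⌈N * t i⌉₊ : ℝ) := by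
      push_cast
      calc ∑ x ∈ F with x i = c, (⌊N * w x⌋₊ : ℝ) ≤ ∑ x ∈ F with x i = c, N * w x :=
            sum_le_sum (fun x _ => Nat.floor_le (mul_nonneg (Nat.cast_nonneg _) (hw x)))
        _ = N * ∑ x ∈ F with x i = c, w x := by rw [mul_sum]
        _ ≤ N * t i := mul_le_mul_of_nonneg_left (hwt i c) (Nat.cast_nonneg _)
        _ ≤ _ := Nat.le_ceil _
    exact_mod_cast h1
  · have h1 : ((∑ i, ⌈N * t i⌉₊ : ℕ) : ℝ) < ((∑ x ∈ F, ⌊N * w x⌋₊ : ℕ) : ℝ) := by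
      push_cast
      have ha : ∑ i, (⌈N * t i⌉₊ : ℝ) ≤ N * ∑ i, t i + m := by
        calc ∑ i, (⌈N * t i⌉₊ : ℝ) ≤ ∑ i, (N * t i + 1) :=
              sum_le_sum (fun i _ => (Nat.ceil_lt_add_one (mul_nonneg (Nat.cast_nonneg _) (ht i))).le)
          _ = _ := by simp [sum_add_distrib, mul_sum]
      have hb : N * ∑ x ∈ F, w x - F.card ≤ ∑ x ∈ F, (⌊N * w x⌋₊ : ℝ) := by
        calc N * ∑ x ∈ F, w x - F.card = ∑ x ∈ F, (N * w x - 1) := by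
              simp [sum_sub_distrib, mul_sum]
          _ ≤ _ := sum_le_sum (fun x _ => (Nat.sub_one_lt_floor _).le)
      rw [hD] at hN
      linarith
    exact_mod_cast h1

open Classical in
/-- Number of elements of a finite type satisfying a predicate. -/
noncomputable def mrCnt {Ω : Type} [Fintype Ω] (P : Ω → Prop) : ℕ := (univ.filter P).card

open Classical in
theorem mrCnt_mono {Ω : Type} [Fintype Ω] {P Q : Ω → Prop} (h : ∀ ω, P ω → Q ω) :
    mrCnt P ≤ mrCnt Q :=
  card_le_card (fun ω hω => by simp at hω ⊢; exact h ω hω)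

open Classical in
theorem mrCnt_le_card {Ω : Type} [Fintype Ω] (P : Ω → Prop) : mrCnt P ≤ Fintype.card Ω :=
  card_filter_le _ _

open Classical in
theorem mrCnt_or {Ω : Type} [Fintype Ω] (P Q : Ω → Prop) :
    mrCnt (fun ω => P ω ∨ Q ω) ≤ mrCnt P + mrCnt Q := by
  unfold mrCnt
  refine le_trans (card_le_card ?_) (card_union_le _ _)
  intro ω hω
  simpa using hω

theorem mrCnt_eq_zero {Ω : Type} [Fintype Ω] (P : Ω → Prop) (h : ∀ ω, ¬ P ω) : mrCnt P = 0 := by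
  unfold mrCnt
  simp [h]

/-- A union bound. -/
theorem mrCnt_exists {Ω ι : Type} [Fintype Ω] (J : Finset ι) (P : ι → Ω → Prop) :
    mrCnt (fun ω => ∃ i ∈ J, P i ω) ≤ ∑ i ∈ J, mrCnt (P i) := by
  classical
  unfold mrCnt
  refine le_trans (card_le_card ?_) card_biUnion_le
  intro ω hω
  simpa using hω

theorem mrCnt_sub {Ω : Type} [Fintype Ω] (P Q : Ω → Prop) :
    mrCnt P ≤ mrCnt (fun ω => P ω ∧ ¬ Q ω) + mrCnt Q := by
  refine le_trans (mrCnt_mono ?_) (mrCnt_or _ _)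
  intro ω h
  by_cases hq : Q ω
  · exact Or.inr hq
  · exact Or.inl ⟨h, hq⟩

theorem mrCnt_inj {Ω Ω' : Type} [Fintype Ω] [Fintype Ω'] (P : Ω → Prop) (Q : Ω' → Prop)
    (f : Ω → Ω') (hf : ∀ ω, P ω → Q (f ω))
    (hinj : ∀ ω ω', P ω → P ω' → f ω = f ω' → ω = ω') : mrCnt P ≤ mrCnt Q := by
  classical
  unfold mrCnt
  apply card_le_card_of_injOn f
  · intro ω hω; simp at hω ⊢; exact hf ω hω
  · intro ω hω ω' hω' h
    simp at hω hω'
    exact hinj ω ω' hω hω' h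

theorem mrCnt_prod {Ω Ω' : Type} [Fintype Ω] [Fintype Ω'] (P : Ω × Ω' → Prop) :
    mrCnt P = ∑ ω, mrCnt (fun ω' => P (ω, ω')) := by
  classical
  unfold mrCnt
  simp only [card_filter]
  rw [Fintype.sum_prod_type]

open Classical in
theorem mrCnt_eq_sum {Ω : Type} [Fintype Ω] (P : Ω → Prop) :
    (mrCnt P : ℝ) = ∑ ω, if P ω then (1 : ℝ) else 0 := by
  unfold mrCnt
  simp

/-- Averaging: few large values. -/
theorem mr_average {Ω : Type} [Fintype Ω] (N : Ω → ℕ) (a b c : ℝ) (ha : 0 ≤ a)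
    (hN : ∀ ω, (N ω : ℝ) ≤ b)
    (h : (a + c) * Fintype.card Ω ≤ ∑ ω, (N ω : ℝ)) :
    c * Fintype.card Ω ≤ b * mrCnt (fun ω => a < N ω) := by
  classical
  have : ∀ ω, (N ω : ℝ) ≤ a + b * (if a < N ω then (1 : ℝ) else 0) := by
    intro ω
    split_ifs with h'
    · have := hN ω; linarith
    · push Not at h'; linarith
  have h2 := sum_le_sum (s := univ) (fun ω _ => this ω)
  rw [sum_add_distrib, ← mul_sum] at h2
  have h3 := mrCnt_eq_sum (fun ω => a < (N ω : ℝ))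
  have h4 : ∑ ω : Ω, a = a * Fintype.card Ω := by simp [mul_comm]
  have h5 : (∑ ω, if a < (N ω : ℝ) then (1 : ℝ) else 0) = mrCnt (fun ω => a < (N ω : ℝ)) := by
    rw [h3]
  rw [h4, h5] at h2
  linarith

/-- Pigeonhole: many dense events have `K` members with a dense intersection. -/
theorem mr_pigeon (c : ℝ) (hc : 0 < c) (K : ℕ) : ∃ (R : ℕ) (c' : ℝ), 0 < c' ∧
    ∀ {ι Ω : Type} [Fintype Ω] (J : Finset ι) (P : ι → Ω → Prop),
      R ≤ J.card → (∀ i ∈ J, c * Fintype.card Ω ≤ mrCnt (P i)) →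
      ∃ I ⊆ J, I.card = K ∧ c' * Fintype.card Ω ≤ mrCnt (fun ω => ∀ i ∈ I, P i ω) := by
  classical
  obtain ⟨R, hR⟩ := exists_nat_gt (2 * K / c + K)
  have hKR : (K : ℝ) < R := by
    have : 0 ≤ 2 * (K : ℝ) / c := by positivity
    linarith
  have hR2 : 2 * (K : ℝ) ≤ c * R := by
    have h1 : 2 * (K : ℝ) / c ≤ R := by
      have : (0 : ℝ) ≤ K := Nat.cast_nonneg _
      linarith
    rw [div_le_iff₀ hc] at h1
    linarith
  have hRpos : (0 : ℝ) < R := lt_of_le_of_lt (Nat.cast_nonneg K) hKR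
  refine ⟨R, c / 2 / 2 ^ R, by positivity, ?_⟩
  intro ι Ω _ J0 P hJ0 hP0
  obtain ⟨J, hJJ, hJ⟩ := exists_subset_card_eq hJ0
  have hP : ∀ i ∈ J, c * Fintype.card Ω ≤ mrCnt (P i) := fun i hi => hP0 i (hJJ hi)
  by_contra hno
  push Not at hno
  set N : Ω → ℕ := fun ω => (J.filter (fun i => P i ω)).card with hN
  set G : Finset Ω := univ.filter (fun ω => K ≤ N ω) with hG
  have hdc : ∑ ω, (N ω : ℝ) = ∑ i ∈ J, (mrCnt (P i) : ℝ) := by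
    simp only [hN, mrCnt, card_eq_sum_ones, sum_filter]
    push_cast
    rw [sum_comm]
  have h1 : c * Fintype.card Ω * R ≤ ∑ ω, (N ω : ℝ) := by
    rw [hdc]
    calc c * Fintype.card Ω * R = ∑ i ∈ J, c * (Fintype.card Ω : ℝ) := by
          rw [sum_const, hJ, nsmul_eq_mul]; ring
      _ ≤ _ := sum_le_sum hP
  have h2 : ∑ ω, (N ω : ℝ) ≤ K * Fintype.card Ω + R * G.card := by
    have : ∀ ω, (N ω : ℝ) ≤ K + (if K ≤ N ω then (R : ℝ) else 0) := by
      intro ω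
      split_ifs with h
      · have : (N ω : ℝ) ≤ R := by
          rw [← hJ]
          exact_mod_cast card_filter_le _ _
        have : (0 : ℝ) ≤ K := Nat.cast_nonneg _
        linarith
      · push Not at h
        have : (N ω : ℝ) ≤ K := by exact_mod_cast h.le
        linarith
    calc ∑ ω, (N ω : ℝ) ≤ ∑ ω, ((K : ℝ) + (if K ≤ N ω then (R : ℝ) else 0)) :=
          sum_le_sum (fun ω _ => this ω)
      _ = _ := by
          rw [sum_add_distrib, ← sum_filter]
          simp [hG]; ring
  have hΩ : (0 : ℝ) ≤ Fintype.card Ω := Nat.cast_nonneg _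
  have h3 : c / 2 * Fintype.card Ω ≤ G.card := by
    have h4 : (K : ℝ) * Fintype.card Ω ≤ c / 2 * R * Fintype.card Ω :=
      mul_le_mul_of_nonneg_right (by linarith) hΩ
    have h5 : R * (c / 2 * Fintype.card Ω) ≤ R * (G.card : ℝ) := by nlinarith
    exact le_of_mul_le_mul_left h5 hRpos
  have h6 : G ⊆ (J.powersetCard K).biUnion (fun I => univ.filter (fun ω => ∀ i ∈ I, P i ω)) := by
    intro ω hω
    have hω' : K ≤ N ω := by simpa [hG] using hω
    obtain ⟨I, hI, hIc⟩ := exists_subset_card_eq hω'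
    rw [mem_biUnion]
    refine ⟨I, mem_powersetCard.2 ⟨hI.trans (filter_subset _ _), hIc⟩, ?_⟩
    simp only [mem_filter, mem_univ, true_and]
    intro i hi
    exact (mem_filter.1 (hI hi)).2
  have hKJ : K ≤ J.card := by
    rw [hJ]; exact_mod_cast hKR.le
  have h7 : (G.card : ℝ) ≤ ∑ I ∈ J.powersetCard K, (mrCnt (fun ω => ∀ i ∈ I, P i ω) : ℝ) := by
    have := (card_le_card h6).trans card_biUnion_le
    have h8 : (G.card : ℝ) ≤ ((∑ I ∈ J.powersetCard K, (univ.filter (fun ω => ∀ i ∈ I, P i ω)).card : ℕ) : ℝ) := by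
      exact_mod_cast this
    push_cast at h8
    refine h8.trans (le_of_eq ?_)
    apply sum_congr rfl
    intro I _
    unfold mrCnt
    congr!
  have h8 : ∑ I ∈ J.powersetCard K, (mrCnt (fun ω => ∀ i ∈ I, P i ω) : ℝ)
      < ∑ I ∈ J.powersetCard K, c / 2 / 2 ^ R * (Fintype.card Ω : ℝ) := by
    apply sum_lt_sum_of_nonempty (powersetCard_nonempty.2 hKJ)
    intro I hI
    rw [mem_powersetCard] at hI
    exact hno I (hI.1.trans hJJ) hI.2
  rw [sum_const, card_powersetCard, nsmul_eq_mul, hJ] at h8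
  have h9 : ((R.choose K : ℕ) : ℝ) ≤ 2 ^ R := by exact_mod_cast Nat.choose_le_two_pow R K
  have h10 : ((R.choose K : ℕ) : ℝ) * (c / 2 / 2 ^ R * (Fintype.card Ω : ℝ)) ≤
      2 ^ R * (c / 2 / 2 ^ R * (Fintype.card Ω : ℝ)) :=
    mul_le_mul_of_nonneg_right h9 (by positivity)
  have h11 : (2 : ℝ) ^ R * (c / 2 / 2 ^ R * (Fintype.card Ω : ℝ)) = c / 2 * Fintype.card Ω := by
    field_simp
  linarith

/-- Erdős: dense `m`-partite relations contain complete `t × ⋯ × t` boxes. -/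
theorem mr_erdos (t : ℕ) (m : ℕ) : ∀ (c : ℝ), 0 < c → ∃ N0 : ℕ,
    ∀ {β : Type} [Fintype β] (P : (Fin m → β) → Prop), N0 ≤ Fintype.card β →
      c * (Fintype.card β : ℝ) ^ m ≤ mrCnt P →
      ∃ A : Fin m → Finset β, (∀ i, (A i).card = t) ∧ ∀ b, (∀ i, b i ∈ A i) → P b := by
  induction m with
  | zero =>
    intro c hc
    refine ⟨0, ?_⟩
    intro β _ P _ h
    refine ⟨fun _ => ∅, fun i => i.elim0, ?_⟩
    intro b _
    by_contra hb
    have : mrCnt P = 0 := by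
      classical
      unfold mrCnt
      rw [card_eq_zero, filter_eq_empty_iff]
      intro x _
      rwa [Subsingleton.elim x b]
    rw [this] at h
    simp at h
    linarith
  | succ m ih =>
    intro c hc
    obtain ⟨R, c', hc', hpig⟩ := mr_pigeon (c / 2) (by linarith) t
    obtain ⟨N0, hN0⟩ := ih c' hc'
    obtain ⟨N1, hN1⟩ := exists_nat_gt (2 * R / c)
    refine ⟨max N0 (N1 + 1), ?_⟩
    intro β _ P hβ h
    classical
    set n := Fintype.card β with hn
    have hnpos : (0 : ℝ) < n := by
      have : 0 < n := by have := le_max_right N0 (N1 + 1); omega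
      exact_mod_cast this
    have hpow : (0 : ℝ) < (n : ℝ) ^ m := by positivity
    have hcard : (Fintype.card (Fin m → β) : ℝ) = (n : ℝ) ^ m := by simp [hn]
    have hsum : ∑ a : β, (mrCnt (fun b' : Fin m → β => P (Fin.cons a b')) : ℝ) = mrCnt P := by
      have h1 := mrCnt_prod (fun p : β × (Fin m → β) => P (Fin.cons p.1 p.2))
      have h2 : mrCnt (fun p : β × (Fin m → β) => P (Fin.cons p.1 p.2)) = mrCnt P := by
        apply le_antisymm
        · apply mrCnt_inj _ _ (fun p : β × (Fin m → β) => (Fin.cons p.1 p.2 : Fin (m + 1) → β))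
          · intro p hp; exact hp
          · rintro ⟨a, b⟩ ⟨a', b'⟩ _ _ h
            have h' := Fin.cons_inj.1 h
            exact Prod.ext h'.1 h'.2
        · apply mrCnt_inj _ _ (fun b : Fin (m + 1) → β => (b 0, Fin.tail b))
          · intro p hp; simpa using hp
          · intro b b' _ _ h
            rw [← Fin.cons_self_tail b, ← Fin.cons_self_tail b']
            simp only [Prod.mk.injEq] at h
            rw [h.1, h.2]
      rw [← h2, h1]
      push_cast
      rfl
    have hav := mr_average (fun a : β => mrCnt (fun b' : Fin m → β => P (Fin.cons a b')))
      (c / 2 * (n : ℝ) ^ m) ((n : ℝ) ^ m) (c / 2 * (n : ℝ) ^ m) (by positivity)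
      (by
        intro a
        rw [← hcard]
        exact_mod_cast mrCnt_le_card _)
      (by
        rw [hsum]
        refine le_trans (le_of_eq ?_) h
        rw [← hn]; ring)
    set J : Finset β := univ.filter
      (fun a => c / 2 * (n : ℝ) ^ m < mrCnt (fun b' : Fin m → β => P (Fin.cons a b'))) with hJ
    have hJc : c / 2 * n ≤ J.card := by
      have : mrCnt (fun a : β => c / 2 * (n : ℝ) ^ m < mrCnt (fun b' : Fin m → β => P (Fin.cons a b'))) = J.card := by
        unfold mrCnt; rw [hJ]; unfold mrCnt; congr!
      rw [this] at hav
      have h' : (n : ℝ) ^ m * (c / 2 * n) ≤ (n : ℝ) ^ m * J.card := by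
        refine le_trans (le_of_eq ?_) hav
        ring
      exact le_of_mul_le_mul_left h' hpow
    have hRJ : R ≤ J.card := by
      have h1 : (N1 : ℝ) ≤ n := by
        have := le_max_right N0 (N1 + 1)
        exact_mod_cast (by omega : N1 ≤ n)
      have h2 : 2 * (R : ℝ) / c < n := lt_of_lt_of_le hN1 h1
      rw [div_lt_iff₀ hc] at h2
      have : (R : ℝ) ≤ J.card := by linarith
      exact_mod_cast this
    obtain ⟨I, hIJ, hIc, hI⟩ := hpig J (fun a (b' : Fin m → β) => P (Fin.cons a b')) hRJ (by
      intro a ha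
      rw [hcard]
      have := (mem_filter.1 ha).2
      exact this.le)
    rw [hcard] at hI
    obtain ⟨A, hA, hAP⟩ := hN0 (fun b' : Fin m → β => ∀ a ∈ I, P (Fin.cons a b'))
      (le_trans (le_max_left _ _) hβ) hI
    refine ⟨Fin.cons I A, ?_, ?_⟩
    · intro i
      refine Fin.cases ?_ (fun j => ?_) i
      · simpa using hIc
      · simpa using hA j
    · intro b hb
      have h0 : b 0 ∈ I := by simpa using hb 0
      have h1 : ∀ j, Fin.tail b j ∈ A j := fun j => by simpa [Fin.tail] using hb j.succ
      have := hAP (Fin.tail b) h1 (b 0) h0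
      rwa [Fin.cons_self_tail] at this

/-- Counting functions for which one coordinate lies in a small set determined by the others. -/
theorem mr_count_coord {ι V : Type} [Fintype ι] [DecidableEq ι] [Fintype V]
    (j : ι) (C : (ι → V) → Finset V) (hC : ∀ f v, C (Function.update f j v) = C f) (c : ℕ)
    (hc : ∀ f, (C f).card ≤ c) :
    mrCnt (fun f : ι → V => f j ∈ C f) * Fintype.card V ≤ c * Fintype.card V ^ Fintype.card ι := by
  classical
  have h1 : mrCnt (fun p : (ι → V) × V => p.1 j ∈ C p.1) ≤
      mrCnt (fun p : (ι → V) × V => p.2 ∈ C p.1) := by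
    apply mrCnt_inj _ _ (fun p => (Function.update p.1 j p.2, p.1 j))
    · intro p hp
      simp only [hC]
      exact hp
    · rintro ⟨f, v⟩ ⟨f', v'⟩ _ _ h
      simp only [Prod.mk.injEq] at h
      have hv : v = v' := by
        have := congrFun h.1 j
        simpa using this
      have hf : f = f' := by
        ext i
        by_cases hi : i = j
        · rw [hi]; exact h.2
        · have := congrFun h.1 i
          simpa [hi] using this
      rw [hv, hf]
  have h2 : mrCnt (fun f : ι → V => f j ∈ C f) * Fintype.card V =
      mrCnt (fun p : (ι → V) × V => p.1 j ∈ C p.1) := by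
    unfold mrCnt
    rw [← card_univ, ← card_product]
    congr 1
    ext p
    simp
  have h3 : mrCnt (fun p : (ι → V) × V => p.2 ∈ C p.1) ≤ c * Fintype.card V ^ Fintype.card ι := by
    rw [mrCnt_prod]
    calc ∑ f : ι → V, mrCnt (fun v => v ∈ C f) ≤ ∑ f : ι → V, c := by
          apply sum_le_sum
          intro f _
          refine le_trans (le_of_eq ?_) (hc f)
          unfold mrCnt
          congr 1
          ext v; simp
      _ = _ := by simp [mul_comm]
  rw [h2]
  exact h1.trans h3

/-- Functions hitting a given set. -/
theorem mr_count_hit {ι V : Type} [Fintype ι] [DecidableEq ι] [Fintype V] (X : Finset V) :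
    mrCnt (fun f : ι → V => ∃ j, f j ∈ X) * Fintype.card V ≤
      Fintype.card ι * X.card * Fintype.card V ^ Fintype.card ι := by
  classical
  have h := mrCnt_exists (univ : Finset ι) (fun j (f : ι → V) => f j ∈ X)
  simp only [mem_univ, true_and] at h
  calc _ ≤ (∑ j : ι, mrCnt (fun f : ι → V => f j ∈ X)) * Fintype.card V :=
        Nat.mul_le_mul_right _ h
    _ = ∑ j : ι, mrCnt (fun f : ι → V => f j ∈ X) * Fintype.card V := sum_mul _ _ _
    _ ≤ ∑ j : ι, X.card * Fintype.card V ^ Fintype.card ι :=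
        sum_le_sum (fun j _ => mr_count_coord j (fun _ => X) (fun _ _ => rfl) _ (fun _ => le_rfl))
    _ = _ := by simp [mul_assoc]

/-- Functions with two coordinates related by a locally finite relation. -/
theorem mr_count_rel {ι V : Type} [Fintype ι] [DecidableEq ι] [Fintype V] (B : V → Finset V) (c : ℕ)
    (hB : ∀ v, (B v).card ≤ c) :
    mrCnt (fun f : ι → V => ∃ i j, i ≠ j ∧ f j ∈ B (f i)) * Fintype.card V ≤
      Fintype.card ι ^ 2 * c * Fintype.card V ^ Fintype.card ι := by
  classical
  have h := mrCnt_exists (univ : Finset (ι × ι))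
    (fun p (f : ι → V) => p.1 ≠ p.2 ∧ f p.2 ∈ B (f p.1))
  have h0 : mrCnt (fun f : ι → V => ∃ i j, i ≠ j ∧ f j ∈ B (f i)) ≤
      mrCnt (fun f : ι → V => ∃ p ∈ (univ : Finset (ι × ι)), p.1 ≠ p.2 ∧ f p.2 ∈ B (f p.1)) := by
    apply mrCnt_mono
    rintro f ⟨i, j, h⟩
    exact ⟨(i, j), mem_univ _, h⟩
  calc _ ≤ (∑ p : ι × ι, mrCnt (fun f : ι → V => p.1 ≠ p.2 ∧ f p.2 ∈ B (f p.1))) * Fintype.card V :=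
        Nat.mul_le_mul_right _ (h0.trans h)
    _ = ∑ p : ι × ι, mrCnt (fun f : ι → V => p.1 ≠ p.2 ∧ f p.2 ∈ B (f p.1)) * Fintype.card V :=
        sum_mul _ _ _
    _ ≤ ∑ p : ι × ι, c * Fintype.card V ^ Fintype.card ι := by
        apply sum_le_sum
        rintro ⟨i, j⟩ _
        by_cases hij : i = j
        · have : mrCnt (fun f : ι → V => i ≠ j ∧ f j ∈ B (f i)) = 0 := by
            unfold mrCnt
            simp [hij]
          simp only [this]
          simp
        · refine le_trans (Nat.mul_le_mul_right _ (mrCnt_mono (fun f hf => hf.2)))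
            (mr_count_coord j (fun f => B (f i)) ?_ _ (fun f => hB _))
          intro f v
          simp [hij]
    _ = _ := by simp [mul_assoc, sq]

/-- Realising an integral weighting of `F` inside a blow-up. -/
theorem mr_realize {m k : ℕ} {β : Type} (F : Finset (Fin m → Fin k))
    (w : (Fin m → Fin k) → ℕ) (t : Fin m → ℕ)
    (hw : ∀ i c, ∑ x ∈ F with x i = c, w x ≤ t i)
    (A : Fin m → Finset β) (hA : ∀ i, t i ≤ (A i).card) :
    ∃ (x : Fin (∑ x ∈ F, w x) → (Fin m → Fin k)) (b : Fin (∑ x ∈ F, w x) → (Fin m → β)),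
      (∀ e, x e ∈ F) ∧ (∀ e i, b e i ∈ A i) ∧
      ∀ e e' i, b e i = b e' i → x e i = x e' i → e = e' := by
  classical
  let E := (x : {x // x ∈ F}) × Fin (w x.1)
  have hE : Fintype.card E = ∑ x ∈ F, w x := by
    simp only [E, Fintype.card_sigma, Fintype.card_fin]
    exact sum_coe_sort F w
  have hemb : ∀ i c, ∃ g : {e : E // e.1.1 i = c} → {a // a ∈ A i}, Function.Injective g := by
    intro i c
    have hcard : Fintype.card {e : E // e.1.1 i = c} ≤ Fintype.card {a // a ∈ A i} := by
      rw [Fintype.card_coe]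
      refine le_trans (le_trans (le_of_eq ?_) (hw i c)) (hA i)
      rw [Fintype.card_subtype]
      have : (univ.filter (fun e : E => e.1.1 i = c)) =
          (univ.filter (fun x : {x // x ∈ F} => x.1 i = c)).sigma (fun x => univ) := by
        ext e
        rw [mem_sigma]
        simp
      rw [this, card_sigma]
      simp only [card_univ, Fintype.card_fin]
      rw [sum_filter, sum_filter]
      exact sum_coe_sort F (fun x => if x i = c then w x else 0)
    obtain ⟨g⟩ := Function.Embedding.nonempty_of_card_le hcard
    exact ⟨g, g.injective⟩
  choose g hg using hemb
  let eq : Fin (∑ x ∈ F, w x) ≃ E := (Fintype.equivFinOfCardEq hE).symm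
  refine ⟨fun e => (eq e).1.1, fun e i => (g i ((eq e).1.1 i) ⟨eq e, rfl⟩).1,
    fun e => (eq e).1.2, fun e i => (g i _ _).2, ?_⟩
  intro e e' i hb hx
  apply eq.injective
  have key : ∀ (a a' : E) (h : a.1.1 i = a'.1.1 i),
      (g i (a.1.1 i) ⟨a, rfl⟩).1 = (g i (a'.1.1 i) ⟨a', rfl⟩).1 → a = a' := by
    intro a a' h hh
    have h2 : (g i (a'.1.1 i) ⟨a, h⟩).1 = (g i (a.1.1 i) ⟨a, rfl⟩).1 := by
      have : ∀ c (hc : a.1.1 i = c), (g i c ⟨a, hc⟩).1 = (g i (a.1.1 i) ⟨a, rfl⟩).1 := by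
        rintro c rfl; rfl
      exact this _ h
    have h3 := hg i (a'.1.1 i) (Subtype.ext (h2.trans hh))
    exact congrArg Subtype.val h3
  exact key _ _ hx hb

theorem mr_pack {V : Type} [DecidableEq V] (k : ℕ) (hk : 0 < k) (W : Finset V) :
    ∃ B : Finset (Finset V), (∀ b ∈ B, b.card = k ∧ b ⊆ W) ∧
      (B : Set (Finset V)).PairwiseDisjoint id ∧ (W \ B.biUnion id).card < k := by
  induction W using Finset.strongInduction with
  | H W ih =>
    by_cases hW : W.card < k
    · refine ⟨∅, by simp, by simp, by simpa using hW⟩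
    · push Not at hW
      obtain ⟨T, hTW, hT⟩ := exists_subset_card_eq hW
      have hTne : T.Nonempty := by rw [← card_pos]; omega
      obtain ⟨B, hB1, hB2, hB3⟩ := ih (W \ T) (sdiff_ssubset hTW hTne)
      refine ⟨insert T B, ?_, ?_, ?_⟩
      · intro b hb
        rcases mem_insert.1 hb with rfl | hb
        · exact ⟨hT, hTW⟩
        · exact ⟨(hB1 b hb).1, (hB1 b hb).2.trans sdiff_subset⟩
      · rw [coe_insert]
        apply hB2.insert
        intro b hb _
        exact (disjoint_sdiff (s := T) (t := W)).mono_right (hB1 b hb).2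
      · rw [biUnion_insert]
        have : W \ (id T ∪ B.biUnion id) = (W \ T) \ B.biUnion id := by
          ext v
          simp only [mem_sdiff, mem_union, id]
          tauto
        rw [this]
        exact hB3

theorem mr_swap {V : Type} [DecidableEq V] {q : ℕ} (H M U : Finset (Finset V))
    (N : Fin q → Finset V) (hM : M ⊆ H) (hMd : (M : Set (Finset V)).PairwiseDisjoint id)
    (hN : ∀ e, N e ∈ H) (hne : ∀ e, (N e).Nonempty)
    (hNd : ∀ e e', e ≠ e' → Disjoint (N e) (N e'))
    (hNM : ∀ e, ∀ b ∈ M, b ∉ U → Disjoint (N e) b) (hU : U.card < q) :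
    ∃ M' ⊆ H, (M' : Set (Finset V)).PairwiseDisjoint id ∧ M.card < M'.card ∧
      ∀ e ∈ M', e ∈ M ∨ ∃ i, e = N i := by
  have hinj : Function.Injective N := by
    intro e e' h
    by_contra hh
    have := hNd e e' hh
    rw [h, disjoint_self_iff_empty] at this
    exact (hne e').ne_empty this
  refine ⟨(M \ U) ∪ univ.image N, ?_, ?_, ?_, ?_⟩
  · apply union_subset (sdiff_subset.trans hM)
    intro e he
    obtain ⟨i, _, rfl⟩ := mem_image.1 he
    exact hN i
  · intro a ha b hb hab
    simp only [coe_union, Set.mem_union, mem_coe, mem_sdiff, mem_image, mem_univ, true_and] at ha hb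
    rcases ha with ha | ⟨i, rfl⟩ <;> rcases hb with hb | ⟨j, rfl⟩
    · exact hMd ha.1 hb.1 hab
    · exact (hNM j a ha.1 ha.2).symm
    · exact hNM i b hb.1 hb.2
    · exact hNd i j (fun h => hab (by rw [h]))
  · have hd : Disjoint (M \ U) (univ.image N) := by
      rw [Finset.disjoint_left]
      intro a ha ha'
      obtain ⟨i, _, rfl⟩ := mem_image.1 ha'
      rw [mem_sdiff] at ha
      have := hNM i _ ha.1 ha.2
      rw [disjoint_self_iff_empty] at this
      exact (hne i).ne_empty this
    rw [card_union_of_disjoint hd, card_image_of_injective _ hinj, card_univ, Fintype.card_fin]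
    have := le_card_sdiff U M
    omega
  · intro e he
    rcases mem_union.1 he with h | h
    · exact Or.inl (mem_sdiff.1 h).1
    · obtain ⟨i, _, rfl⟩ := mem_image.1 h
      exact Or.inr ⟨i, rfl⟩

theorem mr_blocks {V β : Type} [Fintype V] [DecidableEq V] [Fintype β] {k m : ℕ} (hk : 0 < k)
    (φ : β → Fin k → V) (hφ : ∀ b c b' c', φ b c = φ b' c' → b = b' ∧ c = c')
    (S : Finset V) (H : Finset (Finset V)) (thr η : ℝ) (hη : 0 < η) (hthr : 0 ≤ thr)
    (Y : Finset V) (hY : ∀ v, v ∉ Y → ∃ b c, v = φ b c)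
    (hYc : (m : ℝ) * Y.card + m ^ 2 * k ≤ η / 2 * Fintype.card V)
    (hn : 0 < Fintype.card V)
    (hS : (thr / (k : ℝ) ^ m + η) * (Fintype.card V : ℝ) ^ m ≤
      mrCnt (fun f : Fin m → V => S ∪ univ.image f ∈ H)) :
    η / 2 * (Fintype.card β : ℝ) ^ m ≤ mrCnt (fun b : Fin m → β => Function.Injective b ∧
      thr < ((univ.filter (fun x : Fin m → Fin k =>
        S ∪ univ.image (fun i => φ (b i) (x i)) ∈ H)).card : ℝ)) := by
  classical
  set n := Fintype.card V with hndef
  have hnR : (0 : ℝ) < n := by exact_mod_cast hn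
  have hkR : (0 : ℝ) < k := by exact_mod_cast hk
  let Bl : V → Finset V := fun v =>
    if h : ∃ b c, v = φ b c then univ.image (φ h.choose) else ∅
  have hBlc : ∀ v, (Bl v).card ≤ k := by
    intro v
    simp only [Bl]
    split_ifs with h
    · exact card_image_le.trans (by simp)
    · simp
  have hBlm : ∀ b c c', φ b c' ∈ Bl (φ b c) := by
    intro b c c'
    have h : ∃ b' c', φ b c = φ b' c' := ⟨b, c, rfl⟩
    simp only [Bl, dif_pos h]
    obtain ⟨c2, hc2⟩ := h.choose_spec
    have := (hφ _ _ _ _ hc2).1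
    rw [← this]
    exact mem_image_of_mem _ (mem_univ _)
  set bad : (Fin m → V) → Prop := fun f => (∃ j, f j ∈ Y) ∨ (∃ i j, i ≠ j ∧ f j ∈ Bl (f i)) with hbad
  have hbadc : (mrCnt bad : ℝ) ≤ η / 2 * (n : ℝ) ^ m := by
    have h1 := mr_count_hit (ι := Fin m) Y
    have h2 := mr_count_rel (ι := Fin m) Bl k hBlc
    have h3 := mrCnt_or (fun f : Fin m → V => ∃ j, f j ∈ Y) (fun f => ∃ i j, i ≠ j ∧ f j ∈ Bl (f i))
    have h4 : mrCnt bad * n ≤ (m * Y.card + m ^ 2 * k) * n ^ m := by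
      simp only [Fintype.card_fin, ← hndef] at h1 h2
      calc _ ≤ _ := Nat.mul_le_mul_right n h3
        _ ≤ _ := by rw [add_mul, add_mul]; exact Nat.add_le_add h1 h2
    have h5 : (mrCnt bad : ℝ) * n ≤ (m * Y.card + m ^ 2 * k) * (n : ℝ) ^ m := by exact_mod_cast h4
    have h6 : (mrCnt bad : ℝ) * n ≤ (η / 2 * (n : ℝ) ^ m) * n := by
      refine h5.trans ((mul_le_mul_of_nonneg_right hYc (by positivity)).trans (le_of_eq (by ring)))
    exact le_of_mul_le_mul_right h6 hnR
  have hgood : (thr / (k : ℝ) ^ m + η / 2) * (n : ℝ) ^ m ≤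
      mrCnt (fun f : Fin m → V => S ∪ univ.image f ∈ H ∧ ¬ bad f) := by
    have h := mrCnt_sub (fun f : Fin m → V => S ∪ univ.image f ∈ H) bad
    have h' : (mrCnt (fun f : Fin m → V => S ∪ univ.image f ∈ H) : ℝ) ≤
      mrCnt (fun f : Fin m → V => S ∪ univ.image f ∈ H ∧ ¬ bad f) + mrCnt bad := by exact_mod_cast h
    linarith
  set G : (Fin m → β) × (Fin m → Fin k) → Prop := fun p => Function.Injective p.1 ∧
    S ∪ univ.image (fun i => φ (p.1 i) (p.2 i)) ∈ H with hG
  -- transfer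
  have htrans : mrCnt (fun f : Fin m → V => S ∪ univ.image f ∈ H ∧ ¬ bad f) ≤ mrCnt G := by
    by_cases hβ : Nonempty β
    swap
    · by_cases hm0 : m = 0
      · subst hm0
        apply mrCnt_inj _ _ (fun _ => (fun i => i.elim0, fun i => i.elim0))
        · rintro f ⟨hf, _⟩
          refine ⟨fun i => i.elim0, ?_⟩
          simpa using hf
        · intro f f' _ _ _
          exact Subsingleton.elim _ _
      · have : mrCnt (fun f : Fin m → V => S ∪ univ.image f ∈ H ∧ ¬ bad f) = 0 := by
          apply mrCnt_eq_zero
          rintro f ⟨_, hf⟩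
          apply hf
          left
          refine ⟨⟨0, by omega⟩, ?_⟩
          by_contra hh
          obtain ⟨b, _⟩ := hY _ hh
          exact hβ ⟨b⟩
        rw [this]; exact Nat.zero_le _
    obtain ⟨b0⟩ := hβ
    have hdec : ∀ v, ∃ p : β × Fin k, v ∉ Y → v = φ p.1 p.2 := by
      intro v
      by_cases hv : v ∈ Y
      · exact ⟨(b0, ⟨0, hk⟩), fun h => absurd hv h⟩
      · obtain ⟨b, c, h⟩ := hY v hv
        exact ⟨(b, c), fun _ => h⟩
    choose ψ hψ using hdec
    have hfe : ∀ f : Fin m → V, ¬ bad f → ∀ i, f i = φ (ψ (f i)).1 (ψ (f i)).2 := by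
      intro f hf i
      apply hψ
      intro h
      exact hf (Or.inl ⟨i, h⟩)
    apply mrCnt_inj _ _ (fun f => (fun i => (ψ (f i)).1, fun i => (ψ (f i)).2))
    · rintro f ⟨hf, hb⟩
      refine ⟨?_, ?_⟩
      · intro i j hij
        by_contra hne
        apply hb
        right
        refine ⟨i, j, hne, ?_⟩
        have hij' : (ψ (f i)).1 = (ψ (f j)).1 := hij
        rw [hfe f hb i, hfe f hb j, hij']
        exact hBlm _ _ _
      · have : (fun i => φ (ψ (f i)).1 (ψ (f i)).2) = f := by
          ext i; exact (hfe f hb i).symm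
        simp only [this]
        exact hf
    · rintro f f' ⟨_, hf⟩ ⟨_, hf'⟩ h
      ext i
      simp only [Prod.mk.injEq] at h
      rw [hfe f hf i, hfe f' hf' i, congrFun h.1 i, congrFun h.2 i]
  set N : (Fin m → β) → ℕ := fun b => if Function.Injective b then
    (univ.filter (fun x : Fin m → Fin k => S ∪ univ.image (fun i => φ (b i) (x i)) ∈ H)).card else 0
    with hN
  have hGN : (mrCnt G : ℝ) = ∑ b, (N b : ℝ) := by
    rw [mrCnt_prod]
    push_cast
    apply sum_congr rfl
    intro b _
    simp only [hN, hG]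
    split_ifs with h
    · simp only [h, true_and]
      unfold mrCnt
      norm_cast
      congr!
    · simp [h, mrCnt]
  have hcard : (k : ℝ) * Fintype.card β ≤ n := by
    have : Function.Injective (fun p : β × Fin k => φ p.1 p.2) := by
      rintro ⟨b, c⟩ ⟨b', c'⟩ h
      have := hφ _ _ _ _ h
      exact Prod.ext this.1 this.2
    have h := Fintype.card_le_of_injective _ this
    simp only [Fintype.card_prod, Fintype.card_fin] at h
    have h' : ((Fintype.card β * k : ℕ) : ℝ) ≤ n := by exact_mod_cast h
    push_cast at h'
    linarith
  have hkm : (0 : ℝ) < (k : ℝ) ^ m := by positivity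
  have hav := mr_average N thr ((k : ℝ) ^ m) (η / 2 * (k : ℝ) ^ m) hthr
    (by
      intro b
      simp only [hN]
      split_ifs
      · have : (univ.filter (fun x : Fin m → Fin k => S ∪ univ.image (fun i => φ (b i) (x i)) ∈ H)).card ≤ k ^ m := by
          refine (card_filter_le _ _).trans ?_
          simp
        exact_mod_cast this
      · simp only [Nat.cast_zero]; positivity)
    (by
      rw [← hGN]
      refine le_trans ?_ (hgood.trans (by exact_mod_cast htrans))
      have h1 : ((k : ℝ) * Fintype.card β) ^ m ≤ (n : ℝ) ^ m := by gcongr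
      have h2 : (thr + η / 2 * (k : ℝ) ^ m) * ((Fintype.card (Fin m → β) : ℕ) : ℝ)
          = (thr / (k : ℝ) ^ m + η / 2) * ((k : ℝ) * Fintype.card β) ^ m := by
        rw [mul_pow]
        simp
        field_simp
      rw [h2]
      apply mul_le_mul_of_nonneg_left h1
      positivity)
  have h1 : (k : ℝ) ^ m * (η / 2 * (Fintype.card β : ℝ) ^ m) ≤
      (k : ℝ) ^ m * mrCnt (fun b => thr < (N b : ℝ)) := by
    refine le_trans (le_of_eq ?_) hav
    simp
    ring
  refine (le_of_mul_le_mul_left h1 hkm).trans ?_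
  have : mrCnt (fun b => thr < (N b : ℝ)) ≤ mrCnt (fun b : Fin m → β => Function.Injective b ∧
      thr < ((univ.filter (fun x : Fin m → Fin k =>
        S ∪ univ.image (fun i => φ (b i) (x i)) ∈ H)).card : ℝ)) := by
    apply mrCnt_mono
    intro b hb
    simp only [hN] at hb
    split_ifs at hb with h
    · exact ⟨h, hb⟩
    · simp only [Nat.cast_zero] at hb
      linarith
  exact_mod_cast this

theorem mr_consts (m k : ℕ) (hm : 2 ≤ m) (hmk : m < k) : ∃ K T : ℕ,
    ∀ F : Finset (Fin m → Fin k), (m : ℝ) * (k : ℝ) ^ (m - 1) - (m - 1) < F.card →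
    ∃ (w : (Fin m → Fin k) → ℕ) (t : Fin m → ℕ),
      (∀ i c, ∑ x ∈ F with x i = c, w x ≤ t i) ∧ ∑ i, t i < ∑ x ∈ F, w x ∧
      ∑ x ∈ F, w x ≤ K ∧ ∀ i, t i ≤ T := by
  classical
  have h : ∀ F : Finset (Fin m → Fin k), ∃ (w : (Fin m → Fin k) → ℕ) (t : Fin m → ℕ),
      (m : ℝ) * (k : ℝ) ^ (m - 1) - (m - 1) < F.card →
      (∀ i c, ∑ x ∈ F with x i = c, w x ≤ t i) ∧ ∑ i, t i < ∑ x ∈ F, w x := by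
    intro F
    by_cases hF : (m : ℝ) * (k : ℝ) ^ (m - 1) - (m - 1) < F.card
    · obtain ⟨w, t, h⟩ := mr_weights m k hm hmk F (by
        have h1 : ((m * k ^ (m - 1) + 1 : ℕ) : ℝ) < ((F.card + m : ℕ) : ℝ) := by
          push_cast; linarith
        have h2 : m * k ^ (m - 1) + 1 < F.card + m := by exact_mod_cast h1
        omega)
      exact ⟨w, t, fun _ => h⟩
    · exact ⟨0, 0, fun h => absurd h hF⟩
  choose w t hwt using h
  refine ⟨∑ F, ∑ x ∈ F, w F x, ∑ F, ∑ i, t F i, fun F hF => ⟨w F, t F, (hwt F hF).1, (hwt F hF).2,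
    ?_, ?_⟩⟩
  · exact single_le_sum (f := fun F => ∑ x ∈ F, w F x) (fun _ _ => Nat.zero_le _) (mem_univ F)
  · intro i
    refine le_trans ?_ (single_le_sum (f := fun F => ∑ i, t F i) (fun _ _ => Nat.zero_le _) (mem_univ F))
    exact single_le_sum (f := fun i => t F i) (fun _ _ => Nat.zero_le _) (mem_univ i)

theorem mr_almost (k d m : ℕ) (hd : 1 ≤ d) (hm : 2 ≤ m) (hkm : k = d + m) (η : ℝ) (hη : 0 < η) :
    ∃ δ : ℝ, 0 < δ ∧ ∃ C n0 : ℕ, ∀ (V : Type) [Fintype V] [DecidableEq V], n0 ≤ Fintype.card V →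
    ∀ H : Finset (Finset V), (∀ e ∈ H, e.card = k) →
    (∀ S : Finset V, S.card = d →
      (((m : ℝ) * (k : ℝ) ^ (m - 1) - (m - 1)) / (k : ℝ) ^ m + η) * (Fintype.card V : ℝ) ^ m ≤
        mrCnt (fun f : Fin m → V => S ∪ univ.image f ∈ H)) →
    ∀ X : Finset V, (X.card : ℝ) ≤ δ * Fintype.card V →
    ∃ M ⊆ H, (M : Set (Finset V)).PairwiseDisjoint id ∧ (∀ e ∈ M, Disjoint e X) ∧
      ((univ \ X) \ M.biUnion id).card ≤ C := by
  classical
  have hk0 : 0 < k := by omega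
  have hmk : m < k := by omega
  set thr : ℝ := (m : ℝ) * (k : ℝ) ^ (m - 1) - (m - 1) with hthr
  have hthr0 : 0 ≤ thr := by
    have h1 : (1 : ℝ) ≤ (k : ℝ) ^ (m - 1) := one_le_pow₀ (by exact_mod_cast hk0)
    have h2 : (0 : ℝ) ≤ m := Nat.cast_nonneg _
    have : (m : ℝ) * 1 ≤ m * (k : ℝ) ^ (m - 1) := mul_le_mul_of_nonneg_left h1 h2
    rw [hthr]; linarith
  obtain ⟨K, T, hKT⟩ := mr_consts m k hm hmk
  set L : ℕ := Fintype.card (Finset (Fin m → Fin k)) with hL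
  have hLpos : 0 < L := Fintype.card_pos
  have hLR : (0 : ℝ) < L := by exact_mod_cast hLpos
  obtain ⟨R0, c', hc', hpig⟩ := mr_pigeon (η / 2 / L) (by positivity) (K + 1)
  obtain ⟨N0, hN0⟩ := mr_erdos (T + 1) m c' hc'
  set R := R0 * L with hR
  have hmR : (0 : ℝ) < m := by exact_mod_cast (by omega : 0 < m)
  have hkR : (0 : ℝ) < k := by exact_mod_cast hk0
  obtain ⟨n1, hn1⟩ := exists_nat_gt ((m * (R * d + k : ℝ) + m ^ 2 * k) / (η / 4))
  refine ⟨min (η / (4 * m)) (1 / 4), by positivity, R * d, n1 + 4 * (R * d + k) + 2 * k * N0 + 1, ?_⟩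
  intro V _ _ hn H hH hS X hX
  set n := Fintype.card V with hndef
  have hnpos : 0 < n := by omega
  -- maximum matching
  let 𝓜 := H.powerset.filter (fun M : Finset (Finset V) => (M : Set (Finset V)).PairwiseDisjoint id ∧ ∀ e ∈ M, Disjoint e X)
  have h𝓜 : 𝓜.Nonempty := ⟨∅, by simp [𝓜]⟩
  obtain ⟨M, hM, hMmax⟩ := exists_max_image 𝓜 Finset.card h𝓜
  simp only [𝓜, mem_filter, mem_powerset] at hM hMmax
  obtain ⟨hMH, hMd, hMX⟩ := hM
  refine ⟨M, hMH, hMd, hMX, ?_⟩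
  by_contra hbig
  push Not at hbig
  set W0 := (univ \ X) \ M.biUnion id with hW0
  -- disjoint d-sets in the leftover
  obtain ⟨σ⟩ : Nonempty ((Fin R × Fin d) ↪ {v // v ∈ W0}) := by
    apply Function.Embedding.nonempty_of_card_le
    simp only [Fintype.card_prod, Fintype.card_fin, Fintype.card_coe]
    exact hbig.le
  let S : Fin R → Finset V := fun i => univ.image (fun j => (σ (i, j)).1)
  have hSinj : ∀ i, Function.Injective (fun j => (σ (i, j)).1) := by
    intro i j j' h
    have := σ.injective (Subtype.ext h)
    exact (Prod.ext_iff.1 this).2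
  have hScard : ∀ i, (S i).card = d := by
    intro i
    simp only [S]
    rw [card_image_of_injective _ (hSinj i)]
    simp
  have hSW : ∀ i, S i ⊆ W0 := by
    intro i v hv
    obtain ⟨j, _, rfl⟩ := mem_image.1 hv
    exact (σ (i, j)).2
  have hSdisj : ∀ i i', i ≠ i' → Disjoint (S i) (S i') := by
    intro i i' hne
    rw [Finset.disjoint_left]
    intro v hv hv'
    obtain ⟨j, _, rfl⟩ := mem_image.1 hv
    obtain ⟨j', _, h⟩ := mem_image.1 hv'
    have := σ.injective (Subtype.ext h)
    exact hne ((Prod.ext_iff.1 this).1).symm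
  set Sg : Finset V := univ.biUnion S with hSg
  have hSgW : Sg ⊆ W0 := by
    intro v hv
    obtain ⟨i, _, hi⟩ := mem_biUnion.1 hv
    exact hSW i hi
  have hSgc : Sg.card ≤ R * d := by
    refine card_biUnion_le.trans ?_
    simp [hScard]
  -- blocks
  obtain ⟨Q, hQ1, hQ2, hQ3⟩ := mr_pack k hk0 (W0 \ Sg)
  set B : Finset (Finset V) := M ∪ Q with hB
  have hBcard : ∀ b ∈ B, b.card = k := by
    intro b hb
    rcases mem_union.1 hb with h | h
    · exact hH b (hMH h)
    · exact (hQ1 b h).1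
  have hMW : ∀ b ∈ M, Disjoint b W0 := by
    intro b hb
    rw [Finset.disjoint_left]
    intro v hv hv'
    rw [hW0, mem_sdiff] at hv'
    exact hv'.2 (mem_biUnion.2 ⟨b, hb, hv⟩)
  have hBd : (B : Set (Finset V)).PairwiseDisjoint id := by
    intro a ha b hb hab
    simp only [hB, coe_union, Set.mem_union, mem_coe] at ha hb
    rcases ha with ha | ha <;> rcases hb with hb | hb
    · exact hMd ha hb hab
    · exact (hMW a ha).mono_right ((hQ1 b hb).2.trans sdiff_subset)
    · exact ((hMW b hb).mono_right ((hQ1 a ha).2.trans sdiff_subset)).symm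
    · exact hQ2 ha hb hab
  have hBSg : ∀ b ∈ B, Disjoint b Sg := by
    intro b hb
    rcases mem_union.1 hb with h | h
    · exact (hMW b h).mono_right hSgW
    · exact (disjoint_sdiff (s := Sg) (t := W0)).symm.mono_left (hQ1 b h).2
  have hBX : ∀ b ∈ B, Disjoint b X := by
    intro b hb
    rcases mem_union.1 hb with h | h
    · exact hMX b h
    · rw [Finset.disjoint_left]
      intro v hv hvX
      have := (hQ1 b h).2 hv
      simp only [hW0, mem_sdiff] at this
      exact this.1.1.2 hvX
  have hSgX : Disjoint Sg X := by
    rw [Finset.disjoint_left]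
    intro v hv hvX
    have := hSgW hv
    simp only [hW0, mem_sdiff] at this
    exact this.1.2 hvX
  let β := {b // b ∈ B}
  have henum : ∀ b : β, Nonempty (Fin k ≃ {v // v ∈ b.1}) := by
    intro b
    exact ⟨(Finset.equivFinOfCardEq (hBcard b.1 b.2)).symm⟩
  let en : ∀ b : β, Fin k ≃ {v // v ∈ b.1} := fun b => (henum b).some
  let φ : β → Fin k → V := fun b c => (en b c).1
  have hφmem : ∀ b c, φ b c ∈ b.1 := fun b c => (en b c).2
  have hφ : ∀ b c b' c', φ b c = φ b' c' → b = b' ∧ c = c' := by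
    intro b c b' c' h
    have hbb : b = b' := by
      by_contra hne
      have := hBd b.2 b'.2 (fun h => hne (Subtype.ext h))
      have := Finset.disjoint_left.1 this (hφmem b c)
      apply this
      rw [h]; exact hφmem b' c'
    subst hbb
    exact ⟨rfl, (en b).injective (Subtype.ext h)⟩
  have hφsurj : ∀ b : β, ∀ v ∈ b.1, ∃ c, v = φ b c := by
    intro b v hv
    obtain ⟨c, hc⟩ := (en b).surjective ⟨v, hv⟩
    exact ⟨c, by simp only [φ, hc]⟩
  set Y : Finset V := univ \ B.biUnion id with hYdef
  have hYsurj : ∀ v, v ∉ Y → ∃ b c, v = φ b c := by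
    intro v hv
    simp only [hYdef, mem_sdiff, mem_univ, true_and, not_not, mem_biUnion, id] at hv
    obtain ⟨b, hb, hv⟩ := hv
    obtain ⟨c, hc⟩ := hφsurj ⟨b, hb⟩ v hv
    exact ⟨⟨b, hb⟩, c, hc⟩
  have hYc : Y.card ≤ X.card + (R * d + k) := by
    have : Y ⊆ X ∪ (Sg ∪ ((W0 \ Sg) \ Q.biUnion id)) := by
      intro v hv
      simp only [hYdef, mem_sdiff, mem_univ, true_and, hB, mem_biUnion, id, mem_union] at hv
      simp only [mem_union, mem_sdiff, mem_biUnion, id, hW0, mem_univ, true_and]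
      by_cases h1 : v ∈ X
      · exact Or.inl h1
      · right
        by_cases h2 : v ∈ Sg
        · exact Or.inl h2
        · right
          refine ⟨⟨⟨h1, ?_⟩, h2⟩, ?_⟩
          · rintro ⟨b, hb, hvb⟩; exact hv ⟨b, Or.inl hb, hvb⟩
          · rintro ⟨b, hb, hvb⟩; exact hv ⟨b, Or.inr hb, hvb⟩
    have h1 := (card_le_card this).trans (card_union_le _ _)
    have h2 := card_union_le Sg ((W0 \ Sg) \ Q.biUnion id)
    omega
  have hnR : ((n1 + 4 * (R * d + k) + 2 * k * N0 + 1 : ℕ) : ℝ) ≤ n := by exact_mod_cast hn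
  push_cast at hnR
  have hYcR : (Y.card : ℝ) ≤ X.card + (R * d + k) := by exact_mod_cast hYc
  have hnR0 : (0 : ℝ) < n := by exact_mod_cast hnpos
  have hX1 : (X.card : ℝ) ≤ η / (4 * m) * n :=
    hX.trans (mul_le_mul_of_nonneg_right (min_le_left _ _) hnR0.le)
  have hX2 : (X.card : ℝ) ≤ 1 / 4 * n :=
    hX.trans (mul_le_mul_of_nonneg_right (min_le_right _ _) hnR0.le)
  have hRd : (0 : ℝ) ≤ (R : ℝ) * d := by positivity
  have hkN : (0 : ℝ) ≤ (k : ℝ) * N0 := by positivity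
  have hn1' : (n1 : ℝ) ≤ n := by
    have : (0 : ℝ) ≤ n1 := Nat.cast_nonneg _
    nlinarith
  have hYcond : (m : ℝ) * Y.card + m ^ 2 * k ≤ η / 2 * n := by
    have h1 : (m : ℝ) * Y.card ≤ m * (η / (4 * m) * n + (R * d + k)) :=
      mul_le_mul_of_nonneg_left (by linarith) hmR.le
    have h2 : (m : ℝ) * (η / (4 * m) * n + (R * d + k)) = η / 4 * n + m * (R * d + k) := by
      field_simp
    have h3 := hn1
    rw [div_lt_iff₀ (by positivity)] at h3
    have h4 : (n1 : ℝ) * (η / 4) ≤ n * (η / 4) := mul_le_mul_of_nonneg_right hn1' (by positivity)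
    linarith
  have hβN : N0 ≤ Fintype.card β := by
    have h1 : n ≤ Y.card + k * B.card := by
      have h2 : (B.biUnion id).card ≤ k * B.card := by
        refine card_biUnion_le.trans ?_
        have h9 : ∑ a ∈ B, (id a).card = ∑ a ∈ B, k := sum_congr rfl (fun b hb => hBcard b hb)
        rw [h9]
        simp [mul_comm]
      have h3 : Y.card + (B.biUnion id).card = n := by
        rw [hYdef, hndef, ← card_univ]
        exact card_sdiff_add_card_eq_card (subset_univ _)
      omega
    have h1R : (n : ℝ) ≤ Y.card + k * B.card := by exact_mod_cast h1
    have h4 : (k : ℝ) * N0 ≤ k * B.card := by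
      have : (0 : ℝ) ≤ n1 := Nat.cast_nonneg _
      nlinarith
    have h5 := le_of_mul_le_mul_left h4 hkR
    have h6 : Fintype.card β = B.card := Fintype.card_coe B
    rw [h6]
    exact_mod_cast h5
  -- colours
  let col : Fin R → (Fin m → β) → Finset (Fin m → Fin k) := fun i b =>
    univ.filter (fun x => S i ∪ univ.image (fun l => φ (b l) (x l)) ∈ H)
  have hdens : ∀ i, η / 2 * (Fintype.card β : ℝ) ^ m ≤
      mrCnt (fun b : Fin m → β => Function.Injective b ∧ thr < ((col i b).card : ℝ)) := by
    intro i
    exact mr_blocks hk0 φ hφ (S i) H thr η hη hthr0 Y hYsurj hYcond hnpos (hS (S i) (hScard i))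
  have hcardβ : ((Fintype.card (Fin m → β) : ℕ) : ℝ) = (Fintype.card β : ℝ) ^ m := by simp
  have hcol : ∀ i, ∃ F : Finset (Fin m → Fin k), η / 2 / L * (Fintype.card β : ℝ) ^ m ≤
      mrCnt (fun b : Fin m → β => Function.Injective b ∧ thr < ((col i b).card : ℝ) ∧ col i b = F) := by
    intro i
    by_contra hno
    push Not at hno
    have h1 := mrCnt_exists (univ : Finset (Finset (Fin m → Fin k)))
      (fun F (b : Fin m → β) => Function.Injective b ∧ thr < ((col i b).card : ℝ) ∧ col i b = F)
    have h2 : mrCnt (fun b : Fin m → β => Function.Injective b ∧ thr < ((col i b).card : ℝ)) ≤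
        mrCnt (fun b : Fin m → β => ∃ F ∈ (univ : Finset (Finset (Fin m → Fin k))),
          Function.Injective b ∧ thr < ((col i b).card : ℝ) ∧ col i b = F) :=
      mrCnt_mono (fun b hb => ⟨col i b, mem_univ _, hb.1, hb.2, rfl⟩)
    have h3 : (mrCnt (fun b : Fin m → β => Function.Injective b ∧ thr < ((col i b).card : ℝ)) : ℝ) ≤
        ∑ F : Finset (Fin m → Fin k), (mrCnt (fun b : Fin m → β => Function.Injective b ∧
          thr < ((col i b).card : ℝ) ∧ col i b = F) : ℝ) := by exact_mod_cast h2.trans h1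
    have h4 : ∑ F : Finset (Fin m → Fin k), (mrCnt (fun b : Fin m → β => Function.Injective b ∧
          thr < ((col i b).card : ℝ) ∧ col i b = F) : ℝ) <
        ∑ F : Finset (Fin m → Fin k), η / 2 / L * (Fintype.card β : ℝ) ^ m :=
      sum_lt_sum_of_nonempty univ_nonempty (fun F _ => hno F)
    rw [sum_const, card_univ, ← hL, nsmul_eq_mul] at h4
    have h5 : (L : ℝ) * (η / 2 / L * (Fintype.card β : ℝ) ^ m) = η / 2 * (Fintype.card β : ℝ) ^ m := by
      field_simp
    have := hdens i
    linarith
  choose Fc hFc using hcol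
  obtain ⟨F, hF⟩ : ∃ F, R0 ≤ (univ.filter (fun i => Fc i = F)).card := by
    by_contra hno
    push Not at hno
    have h1 : (univ : Finset (Fin R)).card = ∑ F, (univ.filter (fun i => Fc i = F)).card :=
      card_eq_sum_card_fiberwise (fun i _ => mem_univ (Fc i))
    have h2 : ∑ F, (univ.filter (fun i => Fc i = F)).card < ∑ F : Finset (Fin m → Fin k), R0 :=
      sum_lt_sum_of_nonempty univ_nonempty (fun F _ => hno F)
    rw [← h1] at h2
    simp only [card_univ, Fintype.card_fin, sum_const, smul_eq_mul] at h2
    rw [hR, mul_comm] at h2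
    exact lt_irrefl _ h2
  obtain ⟨I, hIJ, hIK, hI⟩ := hpig (univ.filter (fun i => Fc i = F))
    (fun i (b : Fin m → β) => Function.Injective b ∧ thr < ((col i b).card : ℝ) ∧ col i b = F) hF (by
      intro i hi
      rw [hcardβ]
      have : Fc i = F := (mem_filter.1 hi).2
      rw [← this]
      exact hFc i)
  rw [hcardβ] at hI
  obtain ⟨A, hA, hAP⟩ := hN0 _ hβN hI
  have hAne : ∀ i, (A i).Nonempty := by
    intro i; rw [← card_pos, hA]; omega
  choose a0 ha0 using hAne
  obtain ⟨i0, hi0⟩ : I.Nonempty := by rw [← card_pos, hIK]; omega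
  have hthrF : thr < F.card := by
    have := hAP a0 ha0 i0 hi0
    rw [← this.2.2]
    exact this.2.1
  obtain ⟨w, t, hw, hlt, hwK, htT⟩ := hKT F hthrF
  have hAd : ∀ i j, ∀ a, a ∈ A i → a ∈ A j → i = j := by
    intro i j a hai haj
    by_contra hne
    have hb : ∀ l, (Function.update (Function.update a0 i a) j a) l ∈ A l := by
      intro l
      by_cases hlj : l = j
      · subst hlj; simpa using haj
      · rw [Function.update_of_ne hlj]
        by_cases hli : l = i
        · subst hli; simpa using hai
        · rw [Function.update_of_ne hli]; exact ha0 l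
    have hinj := (hAP _ hb i0 hi0).1
    apply hne
    apply hinj
    rw [Function.update_of_ne hne]
    simp
  have hsub : ∀ i, ∃ A' ⊆ A i, A'.card = t i := by
    intro i
    apply exists_subset_card_eq
    rw [hA]
    have := htT i
    omega
  choose A' hA'A hA't using hsub
  set q := ∑ x ∈ F, w x with hq
  obtain ⟨x, b, hxF, hbA, hxb⟩ := mr_realize F w t hw A' (fun i => (hA't i).ge)
  obtain ⟨ι⟩ : Nonempty (Fin q ↪ {i // i ∈ I}) := by
    apply Function.Embedding.nonempty_of_card_le
    simp only [Fintype.card_fin, Fintype.card_coe, hIK]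
    omega
  let Tl : Fin q → Finset V := fun e => univ.image (fun l => φ (b e l) (x e l))
  let N : Fin q → Finset V := fun e => S (ι e).1 ∪ Tl e
  have hNH : ∀ e, N e ∈ H := by
    intro e
    have h1 := (hAP (b e) (fun l => hA'A l (hbA e l)) (ι e).1 (ι e).2).2.2
    have h2 := hxF e
    rw [← h1] at h2
    exact (mem_filter.1 h2).2
  have hTlB : ∀ e, Disjoint (Tl e) Sg := by
    intro e
    rw [Finset.disjoint_left]
    intro v hv
    obtain ⟨l, _, rfl⟩ := mem_image.1 hv
    exact Finset.disjoint_left.1 (hBSg _ (b e l).2) (hφmem _ _)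
  have hSSg : ∀ i, S i ⊆ Sg := fun i => subset_biUnion_of_mem S (mem_univ i)
  have hNd : ∀ e e', e ≠ e' → Disjoint (N e) (N e') := by
    intro e e' hne
    simp only [N]
    rw [disjoint_union_left, disjoint_union_right, disjoint_union_right]
    refine ⟨⟨?_, ?_⟩, ?_, ?_⟩
    · apply hSdisj
      intro h
      exact hne (ι.injective (Subtype.ext h))
    · exact ((hTlB e').mono_right (hSSg _)).symm
    · exact (hTlB e).mono_right (hSSg _)
    · rw [Finset.disjoint_left]
      intro v hv hv'
      obtain ⟨l, _, rfl⟩ := mem_image.1 hv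
      obtain ⟨l', _, h⟩ := mem_image.1 hv'
      obtain ⟨h1, h2⟩ := hφ _ _ _ _ h
      have hll : l' = l := hAd l' l _ (hA'A _ (hbA e' l')) (by rw [h1]; exact hA'A _ (hbA e l))
      subst hll
      exact hne (hxb e' e l' h1 h2).symm
  let U : Finset (Finset V) := (univ.biUnion A').image Subtype.val
  have hUc : U.card < q := by
    refine lt_of_le_of_lt (card_image_le.trans card_biUnion_le) ?_
    simp only [hA't]
    exact hlt
  obtain ⟨M', hM'H, hM'd, hM'c, hM'm⟩ := mr_swap H M U N hMH hMd hNH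
    (by
      intro e
      rw [← card_pos, hH _ (hNH e)]
      exact hk0)
    hNd
    (by
      intro e c hc hcU
      simp only [N]
      rw [disjoint_union_left]
      refine ⟨((hBSg c (mem_union_left _ hc)).mono_right (hSSg _)).symm, ?_⟩
      rw [Finset.disjoint_left]
      intro v hv hvc
      obtain ⟨l, _, rfl⟩ := mem_image.1 hv
      have hbc : (b e l).1 = c := by
        by_contra hne
        exact Finset.disjoint_left.1 (hBd (b e l).2 (mem_union_left _ hc) hne) (hφmem _ _) hvc
      apply hcU
      rw [← hbc]
      exact mem_image_of_mem _ (mem_biUnion.2 ⟨l, mem_univ _, hbA e l⟩))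
    hUc
  have := hMmax M' ⟨hM'H, hM'd, by
    intro e he
    rcases hM'm e he with h | ⟨i, rfl⟩
    · exact hMX e h
    · simp only [N]
      rw [disjoint_union_left]
      refine ⟨hSgX.mono_left (hSSg _), ?_⟩
      rw [Finset.disjoint_left]
      intro v hv
      obtain ⟨l, _, rfl⟩ := mem_image.1 hv
      exact Finset.disjoint_left.1 (hBX _ (b i l).2) (hφmem _ _)⟩
  omega

theorem mrCnt_true {Ω : Type} [Fintype Ω] : mrCnt (fun _ : Ω => True) = Fintype.card Ω := by
  unfold mrCnt
  simp

/-- Ordered versions of the degree. -/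
theorem mr_deg {V : Type} [Fintype V] [DecidableEq V] (H : Finset (Finset V)) (d m : ℕ)
    (hH : ∀ e ∈ H, e.card = d + m) (S : Finset V) (hS : S.card = d) :
    m.factorial * (H.filter fun e => S ⊆ e).card ≤
      mrCnt (fun f : Fin m → V => S ∪ univ.image f ∈ H) := by
  classical
  let E := {e // e ∈ H.filter fun e => S ⊆ e}
  have hE : ∀ e : E, Nonempty (Fin m ≃ {v // v ∈ e.1 \ S}) := by
    intro e
    have he := mem_filter.1 e.2
    have h1 := card_sdiff_add_card_eq_card he.2
    have h2 := hH _ he.1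
    refine ⟨(Fintype.equivFinOfCardEq ?_).symm⟩
    rw [Fintype.card_coe]
    omega
  let g : ∀ e : E, Fin m ≃ {v // v ∈ e.1 \ S} := fun e => (hE e).some
  have hun : ∀ (e : E) (σ : Equiv.Perm (Fin m)),
      S ∪ univ.image (fun j => (g e (σ j)).1) = e.1 := by
    intro e σ
    have he := mem_filter.1 e.2
    ext v
    simp only [mem_union, mem_image, mem_univ, true_and]
    constructor
    · rintro (h | ⟨j, rfl⟩)
      · exact he.2 h
      · exact (mem_sdiff.1 (g e (σ j)).2).1
    · intro hv
      by_cases hvS : v ∈ S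
      · exact Or.inl hvS
      · right
        refine ⟨σ.symm ((g e).symm ⟨v, mem_sdiff.2 ⟨hv, hvS⟩⟩), ?_⟩
        simp
  have h := mrCnt_inj (fun _ : E × Equiv.Perm (Fin m) => True)
    (fun f : Fin m → V => S ∪ univ.image f ∈ H) (fun p j => (g p.1 (p.2 j)).1)
    (by
      rintro ⟨e, σ⟩ _
      simp only [hun]
      exact (mem_filter.1 e.2).1)
    (by
      rintro ⟨e, σ⟩ ⟨e', σ'⟩ _ _ h
      have h1 : e = e' := by
        apply Subtype.ext
        rw [← hun e σ, ← hun e' σ']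
        simp only at h
        rw [h]
      subst h1
      have h2 : σ = σ' := by
        ext j
        have h3 := congrFun h j
        have h4 := (g e).injective (Subtype.ext h3)
        rw [h4]
      rw [h2])
  refine le_trans (le_of_eq ?_) h
  rw [mrCnt_true, Fintype.card_prod, Fintype.card_perm, Fintype.card_fin, mul_comm]
  congr 1
  exact (Fintype.card_coe _).symm

/-- From degrees of d-sets to degrees of vertices. -/
theorem mr_deg1 {V : Type} [Fintype V] [DecidableEq V] (H : Finset (Finset V)) (d m : ℕ) (a : ℝ)
    (ha : 0 ≤ a)
    (hS : ∀ S : Finset V, S.card = d + 1 → a * (Fintype.card V : ℝ) ^ m ≤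
      mrCnt (fun f : Fin m → V => S ∪ univ.image f ∈ H)) (v : V) :
    a * ((Fintype.card V : ℝ) - (d ^ 2 + d)) * (Fintype.card V : ℝ) ^ (d + m) ≤
      Fintype.card V * mrCnt (fun g : Fin (d + m) → V => {v} ∪ univ.image g ∈ H) := by
  classical
  set n := Fintype.card V with hn
  have h1 : mrCnt (fun p : (Fin d → V) × (Fin m → V) => ({v} ∪ univ.image p.1) ∪ univ.image p.2 ∈ H)
      ≤ mrCnt (fun g : Fin (d + m) → V => {v} ∪ univ.image g ∈ H) := by
    apply mrCnt_inj _ _ (fun p => Fin.append p.1 p.2)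
    · rintro ⟨p, f⟩ h
      convert h using 1
      simp only
      rw [union_assoc]
      congr 1
      ext x
      simp only [mem_image, mem_univ, true_and, mem_union]
      constructor
      · rintro ⟨i, rfl⟩
        refine Fin.addCases (fun i => ?_) (fun i => ?_) i
        · left; exact ⟨i, by simp⟩
        · right; exact ⟨i, by simp⟩
      · rintro (⟨i, rfl⟩ | ⟨i, rfl⟩)
        · exact ⟨Fin.castAdd m i, by simp⟩
        · exact ⟨Fin.natAdd d i, by simp⟩
    · rintro ⟨p, f⟩ ⟨p', f'⟩ _ _ h
      have e1 : p = p' := by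
        ext i
        simpa using congrFun h (Fin.castAdd m i)
      have e2 : f = f' := by
        ext i
        simpa using congrFun h (Fin.natAdd d i)
      rw [e1, e2]
  rw [mrCnt_prod] at h1
  set good : (Fin d → V) → Prop := fun p => ({v} ∪ univ.image p : Finset V).card = d + 1 with hgood
  have h2 : (mrCnt good : ℝ) * (a * (n : ℝ) ^ m) ≤
      mrCnt (fun g : Fin (d + m) → V => {v} ∪ univ.image g ∈ H) := by
    have h1R : (∑ p : Fin d → V, (mrCnt (fun f : Fin m → V =>
        ({v} ∪ univ.image p) ∪ univ.image f ∈ H) : ℝ)) ≤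
        mrCnt (fun g : Fin (d + m) → V => {v} ∪ univ.image g ∈ H) := by exact_mod_cast h1
    refine le_trans ?_ h1R
    rw [mrCnt_eq_sum, sum_mul]
    apply sum_le_sum
    intro p _
    split_ifs with hp
    · rw [one_mul]
      exact hS _ hp
    · simp
  have h3 : (Fintype.card (Fin d → V)) ≤ mrCnt good +
      (mrCnt (fun p : Fin d → V => ∃ j, p j ∈ ({v} : Finset V)) +
       mrCnt (fun p : Fin d → V => ∃ i j, i ≠ j ∧ p j ∈ ({p i} : Finset V))) := by
    have h4 : (Fintype.card (Fin d → V)) = mrCnt (fun _ : Fin d → V => True) := by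
      unfold mrCnt; simp
    rw [h4]
    refine le_trans (mrCnt_mono ?_) ((mrCnt_or _ _).trans (Nat.add_le_add_left (mrCnt_or _ _) _))
    intro p _
    by_cases hj : ∃ j, p j ∈ ({v} : Finset V)
    · exact Or.inr (Or.inl hj)
    · by_cases hij : ∃ i j, i ≠ j ∧ p j ∈ ({p i} : Finset V)
      · exact Or.inr (Or.inr hij)
      · left
        push Not at hj hij
        simp only [mem_singleton] at hj hij
        simp only [hgood]
        rw [card_union_of_disjoint, card_image_of_injective]
        · simp [add_comm]
        · intro i j h
          by_contra hne
          exact hij i j hne h.symm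
        · rw [disjoint_singleton_left]
          simp only [mem_image, mem_univ, true_and, not_exists]
          exact hj
  have h5 := mr_count_hit (ι := Fin d) ({v} : Finset V)
  have h6 := mr_count_rel (ι := Fin d) (fun v : V => ({v} : Finset V)) 1 (by simp)
  simp only [Fintype.card_fun, Fintype.card_fin, card_singleton, ← hn] at h3 h5 h6
  set g0 := mrCnt good
  have h7 : n ^ d * n ≤ n * g0 + (d ^ 2 + d) * n ^ d := by
    have := Nat.mul_le_mul_right n h3
    nlinarith
  have h7R : (n : ℝ) ^ d * n ≤ n * g0 + (d ^ 2 + d) * (n : ℝ) ^ d := by exact_mod_cast h7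
  calc _ = (a * (n : ℝ) ^ m) * (((n : ℝ) - (d ^ 2 + d)) * (n : ℝ) ^ d) := by ring
    _ ≤ (a * (n : ℝ) ^ m) * (n * g0) := by
        apply mul_le_mul_of_nonneg_left _ (by positivity)
        linarith
    _ = n * (g0 * (a * (n : ℝ) ^ m)) := by ring
    _ ≤ _ := mul_le_mul_of_nonneg_left h2 (Nat.cast_nonneg _)

/-- Deterministic selection through a potential function. -/
theorem mr_select {Ω T : Type} [Fintype Ω] [DecidableEq Ω] [Fintype T] [Nonempty Ω]
    (good : Finset Ω → Ω → Prop) (A : T → Ω → Prop) [∀ t, DecidablePred (A t)]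
    (Inv : Finset Ω → Prop) (h0 : Inv ∅)
    (hins : ∀ L ω, Inv L → good L ω → Inv (insert ω L)) (hnot : ∀ L ω, good L ω → ω ∉ L)
    (c : ℝ) (hc1 : c ≤ 1) (r : ℕ)
    (h : ∀ L, Inv L → L.card ≤ r → ∀ t, c * Fintype.card Ω ≤ mrCnt (fun ω => good L ω ∧ A t ω)) :
    ∀ j ≤ r, ∃ L, L.card ≤ j ∧ Inv L ∧
      ∑ t, (1 / 2 : ℝ) ^ (L.filter (A t)).card ≤ Fintype.card T * (1 - c / 2) ^ j := by
  classical
  intro j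
  induction j with
  | zero =>
    intro _
    exact ⟨∅, by simp, h0, by simp⟩
  | succ j ih =>
    intro hj
    obtain ⟨L, hLc, hLI, hL⟩ := ih (by omega)
    let ext : Ω → Finset Ω := fun ω => if good L ω then insert ω L else L
    have key : ∀ t, ∑ ω, (1 / 2 : ℝ) ^ ((ext ω).filter (A t)).card ≤
        Fintype.card Ω * ((1 / 2 : ℝ) ^ (L.filter (A t)).card * (1 - c / 2)) := by
      intro t
      have e1 : ∀ ω, (1 / 2 : ℝ) ^ ((ext ω).filter (A t)).card ≤
          (1 / 2 : ℝ) ^ (L.filter (A t)).card *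
            (1 - 1 / 2 * (if good L ω ∧ A t ω then (1 : ℝ) else 0)) := by
        intro ω
        by_cases hg : good L ω
        · simp only [ext, hg, if_true, true_and]
          by_cases hA : A t ω
          · rw [filter_insert, if_pos hA, card_insert_of_notMem, if_pos hA, pow_succ]
            · norm_num
            · intro hm
              exact hnot L ω hg (mem_filter.1 hm).1
          · rw [filter_insert, if_neg hA, if_neg hA]
            simp
        · simp [ext, hg]
      refine (sum_le_sum (fun ω _ => e1 ω)).trans ?_
      have e2 : (∑ ω, if good L ω ∧ A t ω then (1 : ℝ) else 0) =
          mrCnt (fun ω => good L ω ∧ A t ω) := by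
        rw [mrCnt_eq_sum]
        congr!
      rw [← mul_sum, sum_sub_distrib, ← mul_sum, e2]
      have h2 := h L hLI (by omega) t
      have h3 : (0 : ℝ) ≤ (1 / 2 : ℝ) ^ (L.filter (A t)).card := by positivity
      simp only [sum_const, card_univ, nsmul_eq_mul, mul_one]
      calc _ ≤ (1 / 2 : ℝ) ^ (L.filter (A t)).card *
            (Fintype.card Ω - 1 / 2 * (c * Fintype.card Ω)) := by
            apply mul_le_mul_of_nonneg_left _ h3
            linarith
        _ = _ := by ring
    have tot : ∑ ω, ∑ t, (1 / 2 : ℝ) ^ ((ext ω).filter (A t)).card ≤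
        ∑ ω : Ω, (∑ t, (1 / 2 : ℝ) ^ (L.filter (A t)).card) * (1 - c / 2) := by
      rw [sum_comm]
      refine (sum_le_sum (fun t _ => key t)).trans ?_
      rw [← mul_sum, ← sum_mul]
      simp
    obtain ⟨ω, _, hω⟩ := exists_le_of_sum_le (univ_nonempty (α := Ω)) tot
    refine ⟨ext ω, ?_, ?_, hω.trans ?_⟩
    · simp only [ext]
      split_ifs
      · exact (card_insert_le _ _).trans (by omega)
      · omega
    · simp only [ext]
      split_ifs with hg
      · exact hins L ω hLI hg
      · exact hLI
    · rw [pow_succ, ← mul_assoc]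
      exact mul_le_mul_of_nonneg_right hL (by linarith)

/-- `X` is the disjoint union of edges of `H`. -/
def mrPM {V : Type} [DecidableEq V] (H : Finset (Finset V)) (X : Finset V) : Prop :=
  ∃ M ⊆ H, (M : Set (Finset V)).PairwiseDisjoint id ∧ M.biUnion id = X

theorem mrPM_union {V : Type} [DecidableEq V] {H : Finset (Finset V)} {X Y : Finset V}
    (hX : mrPM H X) (hY : mrPM H Y) (hXY : Disjoint X Y) : mrPM H (X ∪ Y) := by
  obtain ⟨M, hM, hMd, rfl⟩ := hX
  obtain ⟨N, hN, hNd, rfl⟩ := hY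
  refine ⟨M ∪ N, union_subset hM hN, ?_, union_biUnion⟩
  have hh : ∀ a ∈ M, ∀ b ∈ N, Disjoint a b := by
    intro a ha b hb
    exact hXY.mono (subset_biUnion_of_mem id ha) (subset_biUnion_of_mem id hb)
  intro a ha b hb hab
  simp only [coe_union, Set.mem_union, mem_coe] at ha hb
  rcases ha with ha | ha <;> rcases hb with hb | hb
  · exact hMd ha hb hab
  · exact hh a ha b hb
  · exact (hh b hb a ha).symm
  · exact hNd ha hb hab

theorem mrPM_family {V ι : Type} [DecidableEq V] [Fintype ι] {H : Finset (Finset V)}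
    (e : ι → Finset V) (he : ∀ i, e i ∈ H) (hd : ∀ i j, i ≠ j → Disjoint (e i) (e j)) :
    mrPM H (univ.biUnion e) := by
  classical
  refine ⟨univ.image e, ?_, ?_, ?_⟩
  · intro x hx
    obtain ⟨i, _, rfl⟩ := mem_image.1 hx
    exact he i
  · intro a ha b hb hab
    simp only [coe_image, coe_univ, Set.image_univ, Set.mem_range] at ha hb
    obtain ⟨i, rfl⟩ := ha
    obtain ⟨j, rfl⟩ := hb
    exact hd i j (fun h => hab (by rw [h]))
  · ext v; simp

theorem mrPM_biUnion {V : Type} [DecidableEq V] {H : Finset (Finset V)} (Z : Finset (Finset V))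
    (hZ : (Z : Set (Finset V)).PairwiseDisjoint id) (h : ∀ z ∈ Z, mrPM H z) :
    mrPM H (Z.biUnion id) := by
  classical
  induction Z using Finset.induction_on with
  | empty => exact ⟨∅, by simp, by simp, by simp⟩
  | insert a s ha ih =>
    rw [biUnion_insert]
    apply mrPM_union (h a (mem_insert_self _ _))
    · exact ih (hZ.subset (by simp)) (fun z hz => h z (mem_insert_of_mem hz))
    · rw [disjoint_biUnion_right]
      intro b hb
      exact hZ (by simp) (by simp [hb]) (fun hab => ha (by rw [hab]; exact hb))

/-- Using the absorbers one at a time. -/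
theorem mr_final {V : Type} [DecidableEq V] (H : Finset (Finset V)) (k : ℕ) (p : ℕ) :
    ∀ (Z : Finset (Finset V)) (W : Finset V), (Z : Set (Finset V)).PairwiseDisjoint id →
    (∀ z ∈ Z, mrPM H z) → (∀ z ∈ Z, Disjoint z W) → W.card = k * p →
    (∀ T ⊆ W, T.card = k → ∃ G ⊆ Z, p ≤ G.card ∧ ∀ z ∈ G, mrPM H (z ∪ T)) →
    mrPM H (Z.biUnion id ∪ W) := by
  induction p with
  | zero =>
    intro Z W hZ hz hzW hW _
    have : W = ∅ := by simpa using hW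
    rw [this, union_empty]
    exact mrPM_biUnion Z hZ hz
  | succ p ih =>
    intro Z W hZ hz hzW hW hT
    obtain ⟨T, hTW, hTc⟩ := exists_subset_card_eq (s := W) (n := k) (by rw [hW]; nlinarith)
    obtain ⟨G, hGZ, hGc, hG⟩ := hT T hTW hTc
    obtain ⟨z, hzG⟩ : G.Nonempty := card_pos.1 (by omega)
    have hzZ := hGZ hzG
    have h1 := ih (Z.erase z) (W \ T) (hZ.subset (by simp))
      (fun y hy => hz y (mem_of_mem_erase hy))
      (fun y hy => (hzW y (mem_of_mem_erase hy)).mono_right sdiff_subset)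
      (by
        have := card_sdiff_add_card_eq_card hTW
        have e : k * (p + 1) = k * p + k := by ring
        omega)
      (by
        intro T' hT' hT'c
        obtain ⟨G', hG'Z, hG'c, hG'⟩ := hT T' (hT'.trans sdiff_subset) hT'c
        refine ⟨G'.erase z, erase_subset_erase _ hG'Z, ?_, fun y hy => hG' y (mem_of_mem_erase hy)⟩
        have := pred_card_le_card_erase (s := G') (a := z)
        omega)
    have h2 := mrPM_union (hG z hzG) h1 (by
      rw [disjoint_union_left, disjoint_union_right, disjoint_union_right]
      refine ⟨⟨?_, (hzW z hzZ).mono_right sdiff_subset⟩, ?_, disjoint_sdiff⟩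
      · rw [disjoint_biUnion_right]
        intro y hy
        exact hZ hzZ (mem_of_mem_erase hy) (ne_of_mem_erase hy).symm
      · rw [disjoint_biUnion_right]
        intro y hy
        exact ((hzW y (mem_of_mem_erase hy)).mono_right hTW).symm)
    convert h2 using 1
    have e1 : Z.biUnion id = z ∪ (Z.erase z).biUnion id := by
      conv_lhs => rw [← insert_erase hzZ]
      rw [biUnion_insert]; rfl
    rw [e1]
    conv_lhs => rw [← union_sdiff_of_subset hTW]
    ext v
    simp only [mem_union]
    tauto

theorem mrCnt_pi {ι Ω : Type} [Fintype ι] [DecidableEq ι] [Fintype Ω] (Q : ι → Ω → Prop) :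
    mrCnt (fun U : ι → Ω => ∀ i, Q i (U i)) = ∏ i, mrCnt (Q i) := by
  classical
  unfold mrCnt
  rw [← Fintype.card_piFinset]
  congr 1
  ext U
  simp [Fintype.mem_piFinset]

theorem mrCnt_inter {Ω : Type} [Fintype Ω] (P Q : Ω → Prop) :
    mrCnt P + mrCnt Q ≤ mrCnt (fun ω => P ω ∧ Q ω) + Fintype.card Ω := by
  classical
  have e : (univ.filter (fun ω => P ω ∧ Q ω)) = univ.filter P ∩ univ.filter Q := by
    ext ω; simp
  have e1 : mrCnt (fun ω => P ω ∧ Q ω) = (univ.filter P ∩ univ.filter Q).card := by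
    rw [← e]; unfold mrCnt; congr!
  rw [e1]
  unfold mrCnt
  rw [← card_union_add_card_inter, add_comm]
  exact Nat.add_le_add_left (card_le_univ _) _

/-- The configuration itself is matched. -/
def mrConfE {V : Type} [DecidableEq V] (H : Finset (Finset V)) (κ : ℕ)
    (ω : Fin κ ⊕ (Fin κ × Fin κ) → V) : Prop :=
  ∀ i, {ω (Sum.inl i)} ∪ univ.image (fun j => ω (Sum.inr (i, j))) ∈ H

/-- The configuration together with `t` is matched. -/
def mrConfA {V : Type} [DecidableEq V] (H : Finset (Finset V)) (κ : ℕ) (t : Fin (κ + 1) → V)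
    (ω : Fin κ ⊕ (Fin κ × Fin κ) → V) : Prop :=
  {t 0} ∪ univ.image (fun i => ω (Sum.inl i)) ∈ H ∧
  ∀ i : Fin κ, {t i.succ} ∪ univ.image (fun j => ω (Sum.inr (i, j))) ∈ H

theorem mr_conf1 {V : Type} [DecidableEq V] (H : Finset (Finset V)) (κ : ℕ)
    (ω : Fin κ ⊕ (Fin κ × Fin κ) → V) (hi : Function.Injective ω) (hE : mrConfE H κ ω) :
    mrPM H (univ.image ω) := by
  classical
  have h := mrPM_family (fun i => {ω (Sum.inl i)} ∪ univ.image (fun j => ω (Sum.inr (i, j)))) hE (by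
    intro i j hij
    rw [Finset.disjoint_left]
    intro v hv hv'
    simp only [mem_union, mem_singleton, mem_image, mem_univ, true_and] at hv hv'
    rcases hv with rfl | ⟨a, rfl⟩ <;> rcases hv' with h | ⟨b, h⟩
    · have := hi h; simp at this; exact hij this
    · have := hi h; simp at this
    · have := hi h; simp at this
    · have := hi h; simp at this; exact hij this.1.symm)
  convert h using 1
  ext v
  simp only [mem_image, mem_univ, true_and, mem_biUnion, mem_union, mem_singleton]
  constructor
  · rintro ⟨x | ⟨i, j⟩, rfl⟩
    · exact ⟨x, Or.inl rfl⟩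
    · exact ⟨i, Or.inr ⟨j, rfl⟩⟩
  · rintro ⟨i, rfl | ⟨j, rfl⟩⟩
    · exact ⟨_, rfl⟩
    · exact ⟨_, rfl⟩

theorem mr_conf2 {V : Type} [DecidableEq V] (H : Finset (Finset V)) (κ : ℕ)
    (ω : Fin κ ⊕ (Fin κ × Fin κ) → V) (hi : Function.Injective ω) (t : Fin (κ + 1) → V)
    (ht : Function.Injective t) (hA : mrConfA H κ t ω)
    (hd : Disjoint (univ.image ω) (univ.image t)) :
    mrPM H (univ.image ω ∪ univ.image t) := by
  classical
  have hne : ∀ x y, ω x ≠ t y := by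
    intro x y h
    exact Finset.disjoint_left.1 hd (mem_image_of_mem _ (mem_univ x))
      (by rw [h]; exact mem_image_of_mem _ (mem_univ y))
  let e : Option (Fin κ) → Finset V := fun o => match o with
    | none => {t 0} ∪ univ.image (fun i => ω (Sum.inl i))
    | some i => {t i.succ} ∪ univ.image (fun j => ω (Sum.inr (i, j)))
  have hns : ∀ i, Disjoint (e none) (e (some i)) := by
    intro i
    rw [Finset.disjoint_left]
    intro v hv hv'
    simp only [e, mem_union, mem_singleton, mem_image, mem_univ, true_and] at hv hv'
    rcases hv with rfl | ⟨a, rfl⟩ <;> rcases hv' with h | ⟨b, h⟩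
    · have := ht h
      exact absurd this (Fin.succ_ne_zero i).symm
    · exact hne _ _ h
    · exact hne _ _ h
    · have := hi h; simp at this
  have h := mrPM_family e (by
      rintro (_ | i)
      · exact hA.1
      · exact hA.2 i) (by
    rintro (_ | i) (_ | j) hij
    · exact absurd rfl hij
    · exact hns j
    · exact (hns i).symm
    · have hij' : i ≠ j := fun h => hij (by rw [h])
      rw [Finset.disjoint_left]
      intro v hv hv'
      simp only [e, mem_union, mem_singleton, mem_image, mem_univ, true_and] at hv hv'
      rcases hv with rfl | ⟨a, rfl⟩ <;> rcases hv' with h | ⟨b, h⟩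
      · have := ht h
        exact hij' (Fin.succ_injective _ this)
      · exact hne _ _ h
      · exact hne _ _ h
      · have := hi h; simp at this; exact hij' this.1.symm)
  convert h using 1
  ext v
  simp only [mem_image, mem_univ, true_and, mem_biUnion, mem_union]
  constructor
  · rintro (⟨x | ⟨i, j⟩, rfl⟩ | ⟨y, rfl⟩)
    · exact ⟨none, by simp [e]⟩
    · exact ⟨some i, by simp [e]⟩
    · refine Fin.cases ?_ (fun i => ?_) y
      · exact ⟨none, by simp [e]⟩
      · exact ⟨some i, by simp [e]⟩
  · rintro ⟨_ | i, hv⟩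
    · simp only [e, mem_union, mem_singleton, mem_image, mem_univ, true_and] at hv
      rcases hv with rfl | ⟨a, rfl⟩
      · exact Or.inr ⟨_, rfl⟩
      · exact Or.inl ⟨_, rfl⟩
    · simp only [e, mem_union, mem_singleton, mem_image, mem_univ, true_and] at hv
      rcases hv with rfl | ⟨a, rfl⟩
      · exact Or.inr ⟨_, rfl⟩
      · exact Or.inl ⟨_, rfl⟩

theorem mr_conf_count {V : Type} [Fintype V] [DecidableEq V] (H : Finset (Finset V)) (κ : ℕ)
    (ε : ℝ) (hε : 0 < ε)
    (hdeg : ∀ v, (1 / 2 + ε) * (Fintype.card V : ℝ) ^ κ ≤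
      mrCnt (fun g : Fin κ → V => {v} ∪ univ.image g ∈ H)) (t : Fin (κ + 1) → V) :
    1 / 2 * (2 * ε) ^ κ * (Fintype.card V : ℝ) ^ (κ + κ * κ) ≤
      mrCnt (fun ω => mrConfE H κ ω ∧ mrConfA H κ t ω) := by
  classical
  set n := Fintype.card V with hn
  have h1 : mrCnt (fun p : (Fin κ → V) × (Fin κ → Fin κ → V) =>
      {t 0} ∪ univ.image p.1 ∈ H ∧ ∀ i, {p.1 i} ∪ univ.image (p.2 i) ∈ H ∧
        {t i.succ} ∪ univ.image (p.2 i) ∈ H) ≤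
      mrCnt (fun ω => mrConfE H κ ω ∧ mrConfA H κ t ω) := by
    apply mrCnt_inj _ _ (fun p x => Sum.elim p.1 (fun q => p.2 q.1 q.2) x)
    · rintro ⟨u, U⟩ ⟨ha, hb⟩
      exact ⟨fun i => (hb i).1, ha, fun i => (hb i).2⟩
    · rintro ⟨u, U⟩ ⟨u', U'⟩ _ _ h
      have e1 : u = u' := by
        ext i
        exact congrFun h (Sum.inl i)
      have e2 : U = U' := by
        ext i j
        exact congrFun h (Sum.inr (i, j))
      rw [e1, e2]
  rw [mrCnt_prod] at h1
  have h1R : (∑ u : Fin κ → V, (mrCnt (fun U : Fin κ → Fin κ → V =>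
      {t 0} ∪ univ.image u ∈ H ∧ ∀ i, {u i} ∪ univ.image (U i) ∈ H ∧
        {t i.succ} ∪ univ.image (U i) ∈ H) : ℝ)) ≤
      mrCnt (fun ω => mrConfE H κ ω ∧ mrConfA H κ t ω) := by exact_mod_cast h1
  have h2 : ∀ v w : V, 2 * ε * (n : ℝ) ^ κ ≤ mrCnt (fun g : Fin κ → V =>
      {v} ∪ univ.image g ∈ H ∧ {w} ∪ univ.image g ∈ H) := by
    intro v w
    have h3 := mrCnt_inter (fun g : Fin κ → V => {v} ∪ univ.image g ∈ H)
      (fun g : Fin κ → V => {w} ∪ univ.image g ∈ H)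
    rw [Fintype.card_fun, Fintype.card_fin, ← hn] at h3
    have h3R := (Nat.cast_le (α := ℝ)).2 h3
    push_cast at h3R
    have h4 := hdeg v
    have h5 := hdeg w
    linarith
  refine le_trans ?_ h1R
  have h6 : (mrCnt (fun u : Fin κ → V => {t 0} ∪ univ.image u ∈ H) : ℝ) *
      (2 * ε * (n : ℝ) ^ κ) ^ κ ≤ ∑ u : Fin κ → V, (mrCnt (fun U : Fin κ → Fin κ → V =>
      {t 0} ∪ univ.image u ∈ H ∧ ∀ i, {u i} ∪ univ.image (U i) ∈ H ∧
        {t i.succ} ∪ univ.image (U i) ∈ H) : ℝ) := by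
    rw [mrCnt_eq_sum, sum_mul]
    apply sum_le_sum
    intro u _
    split_ifs with hu
    · simp only [hu, true_and, one_mul]
      rw [mrCnt_pi (fun i (g : Fin κ → V) => {u i} ∪ univ.image g ∈ H ∧
        {t i.succ} ∪ univ.image g ∈ H)]
      push_cast
      calc (2 * ε * (n : ℝ) ^ κ) ^ κ = ∏ _i : Fin κ, (2 * ε * (n : ℝ) ^ κ) := by simp
        _ ≤ _ := prod_le_prod (fun _ _ => by positivity) (fun i _ => h2 _ _)
    · simp
  refine le_trans ?_ h6
  calc _ = (1 / 2 * (n : ℝ) ^ κ) * (2 * ε * (n : ℝ) ^ κ) ^ κ := by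
        rw [mul_pow (2 * ε), ← pow_mul, pow_add]; ring
    _ ≤ _ := by
        apply mul_le_mul_of_nonneg_right _ (by positivity)
        refine le_trans ?_ (hdeg (t 0))
        apply mul_le_mul_of_nonneg_right _ (by positivity)
        linarith

theorem mr_decay (x : ℝ) (hx0 : 0 < x) (hx1 : x < 1) (k D q : ℕ) (hD : 0 < D) :
    ∃ n0 : ℕ, ∀ n ≥ n0, (n : ℝ) ^ k * x ^ (n / D) < (1 / 2) ^ q := by
  have h := tendsto_pow_const_mul_const_pow_of_abs_lt_one k (by rwa [abs_of_pos hx0] : |x| < 1)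
  have hpos : (0 : ℝ) < (1 / 2) ^ q * x / D ^ k := by positivity
  have h2 := (h.eventually (gt_mem_nhds hpos))
  obtain ⟨r0, hr0⟩ := Filter.eventually_atTop.1 h2
  refine ⟨D * r0, fun n hn => ?_⟩
  have h3 : r0 ≤ n / D := by
    rw [Nat.le_div_iff_mul_le hD]; linarith
  have h4 := hr0 (n / D + 1) (by omega)
  have h5 : n ≤ D * (n / D + 1) := by
    have := Nat.div_add_mod n D
    have := Nat.mod_lt n hD
    nlinarith
  have h5R : (n : ℝ) ≤ D * ((n / D + 1 : ℕ) : ℝ) := by exact_mod_cast h5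
  rw [lt_div_iff₀ (by positivity), pow_succ] at h4
  have h6 : (n : ℝ) ^ k ≤ (D : ℝ) ^ k * ((n / D + 1 : ℕ) : ℝ) ^ k := by
    rw [← mul_pow]
    exact pow_le_pow_left₀ (Nat.cast_nonneg _) h5R k
  have h7 : (n : ℝ) ^ k * x ^ (n / D) * x < (1 / 2) ^ q * x := by
    calc _ = (n : ℝ) ^ k * (x ^ (n / D) * x) := by ring
      _ ≤ ((D : ℝ) ^ k * ((n / D + 1 : ℕ) : ℝ) ^ k) * (x ^ (n / D) * x) :=
          mul_le_mul_of_nonneg_right h6 (by positivity)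
      _ = ((n / D + 1 : ℕ) : ℝ) ^ k * (x ^ (n / D) * x) * D ^ k := by ring
      _ < _ := h4
  exact lt_of_mul_lt_mul_right h7 hx0.le

theorem mr_absorb (κ : ℕ) (hκ : 1 ≤ κ) (ε : ℝ) (hε : 0 < ε) (hε2 : ε ≤ 1 / 2) (δ : ℝ) (hδ : 0 < δ)
    (q : ℕ) :
    ∃ n0 : ℕ, ∀ (V : Type) [Fintype V] [DecidableEq V], n0 ≤ Fintype.card V →
    ∀ H : Finset (Finset V),
    (∀ v, (1 / 2 + ε) * (Fintype.card V : ℝ) ^ κ ≤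
      mrCnt (fun g : Fin κ → V => {v} ∪ univ.image g ∈ H)) →
    ∃ Z : Finset (Finset V), (Z : Set (Finset V)).PairwiseDisjoint id ∧ (∀ z ∈ Z, mrPM H z) ∧
      ((Z.biUnion id).card : ℝ) ≤ δ * Fintype.card V ∧
      ∀ T : Finset V, T.card = κ + 1 → ∃ G ⊆ Z, q ≤ G.card ∧
        ∀ z ∈ G, Disjoint z T → mrPM H (z ∪ T) := by
  classical
  set I := κ + κ * κ with hI
  have hI0 : 0 < I := by omega
  set c0 : ℝ := 1 / 2 * (2 * ε) ^ κ with hc0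
  have hc0pos : 0 < c0 := by positivity
  have hc0le : c0 ≤ 1 := by
    have : (2 * ε) ^ κ ≤ 1 := pow_le_one₀ (by positivity) (by linarith)
    rw [hc0]; linarith
  obtain ⟨D, hD⟩ := exists_nat_gt (4 * (I : ℝ) ^ 2 / c0 + I / δ)
  have hIR : (0 : ℝ) < I := by exact_mod_cast hI0
  have hD0R : (0 : ℝ) < D := lt_trans (by positivity) hD
  have hD0 : 0 < D := by exact_mod_cast hD0R
  have hD1 : 4 * (I : ℝ) ^ 2 ≤ c0 * D := by
    have : 4 * (I : ℝ) ^ 2 / c0 ≤ D := by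
      have : 0 < (I : ℝ) / δ := by positivity
      linarith
    rw [div_le_iff₀ hc0pos] at this
    linarith
  have hD2 : (I : ℝ) ≤ δ * D := by
    have : (I : ℝ) / δ ≤ D := by
      have : 0 < 4 * (I : ℝ) ^ 2 / c0 := by positivity
      linarith
    rw [div_le_iff₀ hδ] at this
    linarith
  obtain ⟨n1, hn1⟩ := mr_decay (1 - c0 / 2 / 2) (by linarith) (by linarith) (κ + 1) D q hD0
  refine ⟨n1 + D, ?_⟩
  intro V _ _ hnV H hdeg
  set n := Fintype.card V with hn
  have hnpos : 0 < n := by omega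
  have hnR : (0 : ℝ) < n := by exact_mod_cast hnpos
  have hDn : (D : ℝ) ≤ n := by exact_mod_cast (by omega : D ≤ n)
  have hVne : Nonempty V := Fintype.card_pos_iff.1 hnpos
  set r := n / D with hr
  have hrD : (r : ℝ) * D ≤ n := by exact_mod_cast Nat.div_mul_le_self n D
  let Ω := Fin κ ⊕ (Fin κ × Fin κ) → V
  have hcard : Fintype.card Ω = n ^ I := by
    simp [Ω, hI, hn]
  let used : Finset Ω → Finset V := fun L => L.biUnion (fun ω => univ.image ω)
  let good : Finset Ω → Ω → Prop := fun L ω =>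
    Function.Injective ω ∧ mrConfE H κ ω ∧ ∀ j, ω j ∉ used L
  let Inv : Finset Ω → Prop := fun L => (∀ ω ∈ L, Function.Injective ω ∧ mrConfE H κ ω) ∧
    ∀ ω ∈ L, ∀ ω' ∈ L, ω ≠ ω' → Disjoint (univ.image ω) (univ.image ω')
  have hused : ∀ L : Finset Ω, (used L).card ≤ L.card * I := by
    intro L
    apply card_biUnion_le_card_mul
    intro ω _
    refine card_image_le.trans ?_
    simp [hI]
  have hnewd : ∀ L ω, good L ω → ∀ ω' ∈ L, Disjoint (univ.image ω) (univ.image ω') := by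
    intro L ω hg ω' hω'
    rw [Finset.disjoint_left]
    intro v hv hv'
    obtain ⟨j, _, rfl⟩ := mem_image.1 hv
    exact hg.2.2 j (mem_biUnion.2 ⟨ω', hω', hv'⟩)
  let j0 : Fin κ ⊕ (Fin κ × Fin κ) := Sum.inl ⟨0, hκ⟩
  have hcount : ∀ L, Inv L → L.card ≤ r → ∀ t : Fin (κ + 1) → V,
      c0 / 2 * Fintype.card Ω ≤ mrCnt (fun ω => good L ω ∧ mrConfA H κ t ω) := by
    intro L _ hLr t
    have h1 := mr_conf_count H κ ε hε hdeg t
    have h2 := mrCnt_sub (fun ω : Ω => mrConfE H κ ω ∧ mrConfA H κ t ω)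
      (fun ω => (∃ i j, i ≠ j ∧ ω j ∈ ({ω i} : Finset V)) ∨ ∃ j, ω j ∈ used L)
    have h3 := mrCnt_or (fun ω : Ω => (∃ i j, i ≠ j ∧ ω j ∈ ({ω i} : Finset V)))
      (fun ω => ∃ j, ω j ∈ used L)
    have h4 := mr_count_rel (ι := Fin κ ⊕ (Fin κ × Fin κ)) (fun v : V => ({v} : Finset V)) 1 (by simp)
    have h5 := mr_count_hit (ι := Fin κ ⊕ (Fin κ × Fin κ)) (used L)
    have h6 : mrCnt (fun ω : Ω => (mrConfE H κ ω ∧ mrConfA H κ t ω) ∧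
        ¬ ((∃ i j, i ≠ j ∧ ω j ∈ ({ω i} : Finset V)) ∨ ∃ j, ω j ∈ used L)) ≤
        mrCnt (fun ω => good L ω ∧ mrConfA H κ t ω) := by
      apply mrCnt_mono
      rintro ω ⟨⟨hE, hA⟩, hno⟩
      push Not at hno
      refine ⟨⟨?_, hE, hno.2⟩, hA⟩
      intro i j hij
      by_contra hne
      exact hno.1 i j hne (by simp [hij])
    have hcι : Fintype.card (Fin κ ⊕ (Fin κ × Fin κ)) = I := by simp [hI]
    rw [hcι, ← hn] at h4 h5
    rw [hcard]
    rw [← hn, ← hI, ← hc0] at h1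
    generalize mrCnt (fun ω : Ω => mrConfE H κ ω ∧ mrConfA H κ t ω) = a1 at *
    generalize mrCnt (fun ω : Ω => (∃ i j, i ≠ j ∧ ω j ∈ ({ω i} : Finset V))) = a2 at *
    generalize mrCnt (fun ω : Ω => ∃ j, ω j ∈ used L) = a3 at *
    have h7 : a1 ≤ mrCnt (fun ω => good L ω ∧ mrConfA H κ t ω) + (a2 + a3) := by omega
    generalize mrCnt (fun ω => good L ω ∧ mrConfA H κ t ω) = a4 at *
    have h7R : (a1 : ℝ) ≤ a4 + (a2 + a3) := by exact_mod_cast h7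
    have h4R : (a2 : ℝ) * n ≤ (I : ℝ) ^ 2 * (n : ℝ) ^ I := by
      have := (Nat.cast_le (α := ℝ)).2 h4
      push_cast at this
      linarith
    have hu : (used L).card ≤ r * I := (hused L).trans (Nat.mul_le_mul_right _ hLr)
    have hnIpos : (0 : ℝ) < (n : ℝ) ^ I := by positivity
    have h5R : (a3 : ℝ) * n ≤ (I : ℝ) ^ 2 * r * (n : ℝ) ^ I := by
      have h5' := (Nat.cast_le (α := ℝ)).2 h5
      push_cast at h5'
      have huR : ((used L).card : ℝ) ≤ r * I := by exact_mod_cast hu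
      refine h5'.trans ?_
      apply mul_le_mul_of_nonneg_right _ hnIpos.le
      calc (I : ℝ) * ((used L).card : ℝ) ≤ I * (r * I) := mul_le_mul_of_nonneg_left huR hIR.le
        _ = _ := by ring
    have h8 : (I : ℝ) ^ 2 ≤ c0 / 4 * n := by
      have := mul_le_mul_of_nonneg_left hDn hc0pos.le
      linarith
    have h9 : (I : ℝ) ^ 2 * r ≤ c0 / 4 * n := by
      have e1 := mul_le_mul_of_nonneg_right hD1 (Nat.cast_nonneg r : (0 : ℝ) ≤ r)
      have e2 := mul_le_mul_of_nonneg_left hrD hc0pos.le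
      nlinarith
    have h10 : ((a2 : ℝ) + a3) * n ≤ (c0 / 2 * (n : ℝ) ^ I) * n := by
      have e1 := mul_le_mul_of_nonneg_right h8 hnIpos.le
      have e2 := mul_le_mul_of_nonneg_right h9 hnIpos.le
      nlinarith
    have h11 := le_of_mul_le_mul_right h10 hnR
    push_cast
    linarith
  have hΩne : Nonempty Ω := ⟨fun _ => hVne.some⟩
  obtain ⟨L, hLr, hLI, hLs⟩ := mr_select (Ω := Ω) (T := Fin (κ + 1) → V) good (mrConfA H κ) Inv
    ⟨by simp, by simp⟩
    (by
      intro L ω hL hg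
      refine ⟨?_, ?_⟩
      · intro ω' hω'
        rcases mem_insert.1 hω' with rfl | h
        · exact ⟨hg.1, hg.2.1⟩
        · exact hL.1 _ h
      · intro a ha b hb hab
        rcases mem_insert.1 ha with rfl | ha'
        · rcases mem_insert.1 hb with rfl | hb'
          · exact absurd rfl hab
          · exact hnewd L _ hg _ hb'
        · rcases mem_insert.1 hb with rfl | hb'
          · exact (hnewd L _ hg _ ha').symm
          · exact hL.2 _ ha' _ hb' hab)
    (by
      intro L ω hg hω
      exact hg.2.2 j0 (mem_biUnion.2 ⟨ω, hω, mem_image_of_mem _ (mem_univ _)⟩))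
    (c0 / 2) (by linarith) r hcount r le_rfl
  have himinj : Set.InjOn (fun ω : Ω => univ.image ω) (L : Set Ω) := by
    intro a ha b hb hab
    by_contra hne
    have h1 := hLI.2 a ha b hb hne
    simp only at hab
    rw [hab, disjoint_self_iff_empty] at h1
    exact notMem_empty (b j0) (h1 ▸ mem_image_of_mem _ (mem_univ _))
  refine ⟨L.image (fun ω => univ.image ω), ?_, ?_, ?_, ?_⟩
  · intro a ha b hb hab
    simp only [coe_image, Set.mem_image, mem_coe] at ha hb
    obtain ⟨x, hx, rfl⟩ := ha
    obtain ⟨y, hy, rfl⟩ := hb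
    exact hLI.2 x hx y hy (fun h => hab (by rw [h]))
  · intro z hz
    obtain ⟨ω, hω, rfl⟩ := mem_image.1 hz
    exact mr_conf1 H κ ω (hLI.1 ω hω).1 (hLI.1 ω hω).2
  · have e1 : (L.image (fun ω => univ.image ω)).biUnion id = used L := by
      rw [image_biUnion]; rfl
    rw [e1]
    have hu : (used L).card ≤ r * I := (hused L).trans (Nat.mul_le_mul_right _ hLr)
    have huR : ((used L).card : ℝ) ≤ r * I := by exact_mod_cast hu
    have e2 := mul_le_mul_of_nonneg_left hD2 (Nat.cast_nonneg r : (0 : ℝ) ≤ r)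
    have e3 := mul_le_mul_of_nonneg_left hrD hδ.le
    nlinarith
  · intro T hT
    let te : Fin (κ + 1) ≃ {v // v ∈ T} := (Fintype.equivFinOfCardEq (by rw [Fintype.card_coe, hT])).symm
    let t : Fin (κ + 1) → V := fun j => (te j).1
    have htinj : Function.Injective t := fun i j h => te.injective (Subtype.ext h)
    have htT : univ.image t = T := by
      ext v
      simp only [mem_image, mem_univ, true_and]
      constructor
      · rintro ⟨j, rfl⟩; exact (te j).2
      · intro hv; exact ⟨te.symm ⟨v, hv⟩, by simp [t]⟩
    refine ⟨(L.filter (mrConfA H κ t)).image (fun ω => univ.image ω),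
      image_subset_image (filter_subset _ _), ?_, ?_⟩
    · rw [card_image_of_injOn (himinj.mono (coe_subset.2 (filter_subset _ _)))]
      have h1 : (1 / 2 : ℝ) ^ (L.filter (mrConfA H κ t)).card < (1 / 2) ^ q := by
        refine lt_of_le_of_lt ?_ (hn1 n (by omega))
        refine le_trans (single_le_sum (f := fun t => (1 / 2 : ℝ) ^ (L.filter (mrConfA H κ t)).card)
          (fun _ _ => by positivity) (mem_univ t)) ?_
        refine hLs.trans (le_of_eq ?_)
        rw [Fintype.card_fun, Fintype.card_fin, ← hn]
        push_cast
        rfl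
      by_contra hlt
      push Not at hlt
      exact absurd h1 (not_lt.2 (pow_le_pow_of_le_one (by norm_num) (by norm_num) hlt.le))
    · intro z hz hzT
      obtain ⟨ω, hω, rfl⟩ := mem_image.1 hz
      obtain ⟨hωL, hωA⟩ := mem_filter.1 hω
      rw [← htT] at hzT ⊢
      exact mr_conf2 H κ ω (hLI.1 ω hωL).1 t htinj hωA hzT

theorem mrPM_dvd {V : Type} [DecidableEq V] {H : Finset (Finset V)} {k : ℕ}
    (hH : ∀ e ∈ H, e.card = k) {X : Finset V} (hX : mrPM H X) : k ∣ X.card := by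
  obtain ⟨M, hM, hMd, rfl⟩ := hX
  rw [card_biUnion (fun a ha b hb hab => hMd ha hb hab)]
  exact dvd_sum (fun e he => by simp [hH e (hM he)])

/-- The threshold is at least one half. -/
theorem mr_half (k d m : ℕ) (hm : 2 ≤ m) (hkm : k = d + m) (hdm : d < m) :
    (1 / 2 : ℝ) ≤ ((m : ℝ) * (k : ℝ) ^ (m - 1) - (m - 1)) / (k : ℝ) ^ m := by
  obtain ⟨i, rfl⟩ : ∃ i, m = i + 2 := ⟨m - 2, by omega⟩
  have hk2 : 2 ≤ k := by omega
  have hk : (0 : ℝ) < k := by exact_mod_cast (by omega : 0 < k)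
  rw [le_div_iff₀ (by positivity)]
  have e : i + 2 - 1 = i + 1 := by omega
  rw [e]
  have h1 : 2 * (i + 1) ≤ k ^ (i + 1) := by
    have h2 : i < 2 ^ i := Nat.lt_two_pow_self
    have h3 : 2 ^ (i + 1) ≤ k ^ (i + 1) := Nat.pow_le_pow_left hk2 _
    have h4 : 2 ^ (i + 1) = 2 * 2 ^ i := by ring
    omega
  have h1R : 2 * ((i : ℝ) + 1) ≤ (k : ℝ) ^ (i + 1) := by exact_mod_cast h1
  have h5 : (k : ℝ) + 1 ≤ 2 * (i + 2) := by exact_mod_cast (by omega : k + 1 ≤ 2 * (i + 2))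
  have h6 : (k : ℝ) ^ (i + 2) = k * (k : ℝ) ^ (i + 1) := by ring
  rw [h6]
  push_cast
  have h7 := mul_le_mul_of_nonneg_right h5 (by positivity : (0 : ℝ) ≤ (k : ℝ) ^ (i + 1))
  nlinarith

/-- From binomial to power form. -/
theorem mr_binom (d m : ℕ) (α ε : ℝ) (hα : 0 ≤ α) (hε : 0 < ε) :
    ∃ n0 : ℕ, ∀ n ≥ n0, (α + ε / 2) * (n : ℝ) ^ m ≤
      m.factorial * ((α + ε) * ((n - d).choose m : ℝ)) := by
  obtain ⟨n1, hn1⟩ := exists_nat_gt (2 * (α + ε) * m * (d + m) / ε)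
  refine ⟨n1 + (d + m) + 1, fun n hn => ?_⟩
  have h1 : (n - (d + m)) ^ m ≤ m.factorial * (n - d).choose m := by
    rw [← Nat.descFactorial_eq_factorial_mul_choose]
    refine le_trans ?_ (Nat.pow_sub_le_descFactorial _ _)
    exact Nat.pow_le_pow_left (by omega) _
  have h1R : ((n : ℝ) - (d + m)) ^ m ≤ m.factorial * ((n - d).choose m : ℝ) := by
    have h := (Nat.cast_le (α := ℝ)).2 h1
    rw [Nat.cast_pow, Nat.cast_sub (by omega)] at h
    push_cast at h
    exact h
  have hnpos : (0 : ℝ) < n := by exact_mod_cast (by omega : 0 < n)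
  have hle : ((d : ℝ) + m) / n ≤ 1 := by
    rw [div_le_one hnpos]
    exact_mod_cast (by omega : d + m ≤ n)
  have h2 := one_add_mul_le_pow (a := -(((d : ℝ) + m) / n)) (by linarith) m
  have h3 : ((n : ℝ) - (d + m)) ^ m = (n : ℝ) ^ m * (1 + -(((d : ℝ) + m) / n)) ^ m := by
    rw [← mul_pow]
    congr 1
    field_simp
    ring
  have hn1' : (n1 : ℝ) ≤ n := by exact_mod_cast (by omega : n1 ≤ n)
  have h4 : (α + ε) * (m * (((d : ℝ) + m) / n)) ≤ ε / 2 := by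
    rw [div_lt_iff₀ hε] at hn1
    have h5 : (α + ε) * (m * (((d : ℝ) + m) / n)) = (2 * (α + ε) * m * (d + m)) / (2 * n) := by
      field_simp
    rw [h5, div_le_iff₀ (by positivity)]
    nlinarith
  calc (α + ε / 2) * (n : ℝ) ^ m ≤ ((α + ε) * (1 + m * -(((d : ℝ) + m) / n))) * (n : ℝ) ^ m := by
        apply mul_le_mul_of_nonneg_right _ (by positivity)
        linarith
    _ = (α + ε) * ((n : ℝ) ^ m * (1 + m * -(((d : ℝ) + m) / n))) := by ring
    _ ≤ (α + ε) * ((n : ℝ) ^ m * (1 + -(((d : ℝ) + m) / n)) ^ m) := by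
        apply mul_le_mul_of_nonneg_left _ (by positivity)
        exact mul_le_mul_of_nonneg_left h2 (by positivity)
    _ ≤ (α + ε) * (m.factorial * ((n - d).choose m : ℝ)) := by
        rw [← h3]
        exact mul_le_mul_of_nonneg_left h1R (by positivity)
    _ = _ := by ring

theorem mr_main (d' m : ℕ) (hm : 2 ≤ m) (hdm : d' + 1 < m) (ε : ℝ) (hε : 0 < ε) :
    ∃ n₀ : ℕ, ∀ n : ℕ, n₀ ≤ n → (d' + 1 + m) ∣ n →
      ∀ H : Finset (Finset (Fin n)), (∀ e ∈ H, e.card = d' + 1 + m) →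
        (∀ S : Finset (Fin n), S.card = d' + 1 →
          ((((m : ℝ) * ((d' + 1 + m : ℕ) : ℝ) ^ (m - 1) - (m - 1)) / ((d' + 1 + m : ℕ) : ℝ) ^ m + ε) *
              ((n - (d' + 1)).choose m : ℝ)) ≤ ((H.filter fun e => S ⊆ e).card : ℝ)) →
        mrPM H univ := by
  classical
  have hα := mr_half (d' + 1 + m) (d' + 1) m hm rfl hdm
  obtain ⟨δ, hδ, C, n1, halm⟩ := mr_almost (d' + 1 + m) (d' + 1) m (by omega) hm rfl (ε / 2) (by linarith)
  generalize ((m : ℝ) * ((d' + 1 + m : ℕ) : ℝ) ^ (m - 1) - (m - 1)) / ((d' + 1 + m : ℕ) : ℝ) ^ m = α at *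
  obtain ⟨n2, habs⟩ := mr_absorb (d' + m) (by omega) (min (ε / 4) (1 / 2)) (by positivity)
    (min_le_right _ _) δ hδ C
  obtain ⟨n3, hbin⟩ := mr_binom (d' + 1) m α ε (by linarith) hε
  obtain ⟨n4, hn4⟩ := exists_nat_gt ((1 / 2 + ε / 2) * ((d' : ℝ) ^ 2 + d') / (ε / 4))
  refine ⟨n1 + n2 + n3 + n4 + (d' ^ 2 + d') + 1, ?_⟩
  intro n hn hkn H hH hdeg
  have hS : ∀ S : Finset (Fin n), S.card = d' + 1 →
      (α + ε / 2) * (Fintype.card (Fin n) : ℝ) ^ m ≤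
        mrCnt (fun f : Fin m → Fin n => S ∪ univ.image f ∈ H) := by
    intro S hSc
    rw [Fintype.card_fin]
    refine (hbin n (by omega)).trans ?_
    have h1 := mr_deg H (d' + 1) m hH S hSc
    have h1R := (Nat.cast_le (α := ℝ)).2 h1
    rw [Nat.cast_mul] at h1R
    refine le_trans ?_ h1R
    exact mul_le_mul_of_nonneg_left (hdeg S hSc) (Nat.cast_nonneg _)
  have hnpos : (0 : ℝ) < n := by exact_mod_cast (by omega : 0 < n)
  have h1deg : ∀ v, (1 / 2 + min (ε / 4) (1 / 2)) * (Fintype.card (Fin n) : ℝ) ^ (d' + m) ≤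
      mrCnt (fun g : Fin (d' + m) → Fin n => {v} ∪ univ.image g ∈ H) := by
    intro v
    have h1 := mr_deg1 H d' m (α + ε / 2) (by linarith) hS v
    rw [Fintype.card_fin] at h1 ⊢
    have hn4' : (n4 : ℝ) ≤ n := by exact_mod_cast (by omega : n4 ≤ n)
    rw [div_lt_iff₀ (by linarith)] at hn4
    have hDn : ((d' : ℝ) ^ 2 + d') ≤ n := by exact_mod_cast (by omega : d' ^ 2 + d' ≤ n)
    have h2 : (1 / 2 + min (ε / 4) (1 / 2)) * (n : ℝ) ≤ (α + ε / 2) * ((n : ℝ) - (d' ^ 2 + d')) := by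
      calc (1 / 2 + min (ε / 4) (1 / 2)) * (n : ℝ) ≤ (1 / 2 + ε / 4) * n := by
            apply mul_le_mul_of_nonneg_right _ hnpos.le
            linarith [min_le_left (ε / 4) (1 / 2 : ℝ)]
        _ ≤ (1 / 2 + ε / 2) * ((n : ℝ) - (d' ^ 2 + d')) := by nlinarith
        _ ≤ _ := by
            apply mul_le_mul_of_nonneg_right _ (by linarith)
            linarith
    have h3 := mul_le_mul_of_nonneg_right h2 (by positivity : (0 : ℝ) ≤ (n : ℝ) ^ (d' + m))
    refine le_of_mul_le_mul_left ?_ hnpos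
    linarith
  obtain ⟨Z, hZd, hZpm, hZc, hZT⟩ := habs (Fin n) (by simp; omega) H h1deg
  obtain ⟨M, hMH, hMd, hMX, hMc⟩ := halm (Fin n) (by simp; omega) H hH hS (Z.biUnion id) hZc
  set X := Z.biUnion id with hX
  set Y := M.biUnion id with hY
  have hXY : Disjoint X Y := by
    rw [hY, disjoint_biUnion_right]
    intro e he
    exact (hMX e he).symm
  have hXpm : mrPM H X := mrPM_biUnion Z hZd hZpm
  have hYpm : mrPM H Y := ⟨M, hMH, hMd, rfl⟩
  set W := (univ \ X) \ Y with hW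
  have hWX : Disjoint X W := disjoint_sdiff.mono_right sdiff_subset
  have hWY : Disjoint W Y := sdiff_disjoint
  have hun : (X ∪ W) ∪ Y = univ := by
    ext v
    simp only [hW, mem_union, mem_sdiff, mem_univ, true_and, iff_true]
    tauto
  have hdW : (d' + 1 + m) ∣ W.card := by
    have h1 : X.card + W.card + Y.card = n := by
      rw [← card_union_of_disjoint hWX, ← card_union_of_disjoint, hun]
      · simp
      · exact disjoint_union_left.2 ⟨hXY, hWY⟩
    have h2 : W.card = n - (X.card + Y.card) := by omega
    rw [h2]
    exact Nat.dvd_sub hkn (dvd_add (mrPM_dvd hH hXpm) (mrPM_dvd hH hYpm))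
  obtain ⟨p, hp⟩ := hdW
  have hpC : p ≤ C := by
    refine le_trans ?_ hMc
    rw [hp]
    exact Nat.le_mul_of_pos_left _ (by omega)
  have hzW : ∀ z ∈ Z, Disjoint z W := fun z hz => hWX.mono_left (subset_biUnion_of_mem id hz)
  have hfin := mr_final H (d' + 1 + m) p Z W hZd hZpm hzW hp (by
    intro T hTW hTc
    obtain ⟨G, hGZ, hGc, hG⟩ := hZT T (by omega)
    exact ⟨G, hGZ, hpC.trans hGc, fun z hz => hG z hz ((hzW z (hGZ hz)).mono_right hTW)⟩)
  rw [← hun]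
  exact mrPM_union hfin hYpm (disjoint_union_left.2 ⟨hXY, hWY⟩)

end MR

/-- Theorem 1.1 (Kühn–Osthus–Townsend): for `1 ≤ d < k/2`, every sufficiently large `n`-vertex
`k`-graph with `k ∣ n` and minimum `d`-degree at least
`((k-d)/k - (k-d-1)/k^{k-d} + ε)·C(n-d,k-d)` has a perfect matching. -/
theorem stmt_11 (k d : ℕ) (hd : 1 ≤ d) (hdk : 2 * d < k) (ε : ℝ) (hε : 0 < ε) :
    ∃ n₀ : ℕ, ∀ n : ℕ, n₀ ≤ n → k ∣ n →
      ∀ H : Finset (Finset (Fin n)), H ⊆ Finset.univ.powersetCard k →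
        (∀ S : Finset (Fin n), S.card = d →
          ((((k : ℝ) - d) / k - ((k : ℝ) - d - 1) / (k : ℝ) ^ (k - d) + ε) *
              ((n - d).choose (k - d) : ℝ)) ≤ ((H.filter fun e => S ⊆ e).card : ℝ)) →
        HasPerfectMatching H := by
  obtain ⟨d', rfl⟩ : ∃ d', d = d' + 1 := ⟨d - 1, by omega⟩
  obtain ⟨m, rfl⟩ : ∃ m, k = d' + 1 + m := ⟨k - (d' + 1), by omega⟩
  obtain ⟨n₀, h⟩ := mr_main d' m (by omega) (by omega) ε hε
  refine ⟨n₀, fun n hn hk H hH hdeg => ?_⟩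
  have hpm := h n hn hk H (fun e he => (Finset.mem_powersetCard.1 (hH he)).2) (by
    intro S hS
    refine le_trans (le_of_eq ?_) (hdeg S hS)
    have e1 : d' + 1 + m - (d' + 1) = m := by omega
    rw [e1]
    congr 2
    have hK : (0 : ℝ) < ((d' + 1 + m : ℕ) : ℝ) := by positivity
    have e2 : ((d' + 1 + m : ℕ) : ℝ) - ((d' + 1 : ℕ) : ℝ) = m := by push_cast; ring
    rw [e2]
    generalize ((d' + 1 + m : ℕ) : ℝ) = K at hK
    obtain ⟨i, rfl⟩ : ∃ i, m = i + 1 := ⟨m - 1, by omega⟩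
    rw [Nat.add_sub_cancel, sub_div, pow_succ]
    congr 1
    field_simp)
  exact hpm
end
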